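/- arXiv:2011.03768 — 3 statements merged into one kernel-verified Lean document; each statement's English description precedes it below -/
import Mathlib

section
/- Let E be a Dedekind complete vector lattice and T an orthomorphism on E. Then both the right multiplication ρ_T and the left multiplication λ_T on L_ob(E) are uo-uo continuous: if a net (S_α) is unbounded order convergent to 0 in L_ob(E), then (S_α T) and (T S_α) are unbounded order convergent to 0 in L_ob(E). -/
open Filter

section Defs

variable {E : Type*} [Lattice E] [AddCommGroup E]
  [CovariantClass E E (· + ·) (· ≤ ·)]

/-- Order convergence of a net, via a downward directed set of dominating elements
with infimum `0` (equivalent to the usual definition with an auxiliary net `y_β ↓ 0`). -/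
def OrderTendsto {ι : Type*} [Preorder ι] (x : ι → E) (l : E) : Prop :=
  ∃ D : Set E, D.Nonempty ∧ DirectedOn (· ≥ ·) D ∧ IsGLB D 0 ∧
    ∀ d ∈ D, ∃ a0 : ι, ∀ a : ι, a0 ≤ a → |x a - l| ≤ d

/-- Unbounded order convergence of a net. -/
def UOTendsto {ι : Type*} [Preorder ι] (x : ι → E) (l : E) : Prop :=
  ∀ y : E, 0 ≤ y → OrderTendsto (fun a => |x a - l| ⊓ y) 0

/-- Dedekind completeness. -/
def DedekindComplete (E : Type*) [Preorder E] : Prop :=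
  ∀ s : Set E, s.Nonempty → BddAbove s → ∃ u, IsLUB s u

variable [Module ℝ E]

/-- An order bounded linear operator. -/
def IsOrderBoundedMap (f : E →ₗ[ℝ] E) : Prop :=
  ∀ x : E, 0 ≤ x → ∃ b : E, ∀ y ∈ Set.Icc (-x) x, |f y| ≤ b

/-- An orthomorphism: an order bounded, band preserving linear operator. -/
def IsOrthomorphism (f : E →ₗ[ℝ] E) : Prop :=
  IsOrderBoundedMap f ∧ ∀ x y : E, |x| ⊓ |y| = 0 → |f x| ⊓ |y| = 0

/-- An order continuous linear operator. -/
def IsOrderContinuousMap (f : E →ₗ[ℝ] E) : Prop :=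
  ∀ {ι : Type*} [Preorder ι] (x : ι → E) (l : E),
    OrderTendsto x l → OrderTendsto (fun a => f (x a)) (f l)

end Defs

/-- `(𝕃, j)` is a realization of the vector lattice `L_ob(E)` of order bounded
linear operators on `E`: `j` is an injective linear map onto the order bounded
operators, and the order of `𝕃` is the operator order. -/
structure IsLobLattice (E 𝕃 : Type*) [Lattice E] [AddCommGroup E]
    [CovariantClass E E (· + ·) (· ≤ ·)] [Module ℝ E]
    [Lattice 𝕃] [AddCommGroup 𝕃] [Module ℝ 𝕃]
    (j : 𝕃 →ₗ[ℝ] E →ₗ[ℝ] E) : Prop where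
  inj : Function.Injective j
  mem_range_iff : ∀ f : E →ₗ[ℝ] E, (∃ S, j S = f) ↔ IsOrderBoundedMap f
  le_iff : ∀ S T : 𝕃, S ≤ T ↔ ∀ x : E, 0 ≤ x → j S x ≤ j T x

lemma inf_eq_zero_of_le {G : Type*} [Lattice G] [AddCommGroup G] {x y x' y' : G}
    (hx' : 0 ≤ x') (hy' : 0 ≤ y') (hx : x' ≤ x) (hy : y' ≤ y) (h : x ⊓ y = 0) : x' ⊓ y' = 0 :=
  le_antisymm ((inf_le_inf hx hy).trans h.le) (le_inf hx' hy')

section LatticeOrderedGroup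

variable {G : Type*} [Lattice G] [AddCommGroup G] [CovariantClass G G (· + ·) (· ≤ ·)]

lemma inf_add_le_of_nonneg {x y z : G} (hx : 0 ≤ x) (hy : 0 ≤ y) (hz : 0 ≤ z) :
    z ⊓ (x + y) ≤ z ⊓ x + z ⊓ y := by
  rw [add_inf, inf_add, inf_add]
  exact le_inf (le_inf (inf_le_left.trans (le_add_of_nonneg_right hz))
    (inf_le_left.trans (le_add_of_nonneg_left hx)))
    (le_inf (inf_le_left.trans (le_add_of_nonneg_right hy)) inf_le_right)

lemma inf_add_eq_zero {x y z : G} (hx : 0 ≤ x) (hy : 0 ≤ y) (hz : 0 ≤ z)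
    (hzx : z ⊓ x = 0) (hzy : z ⊓ y = 0) : z ⊓ (x + y) = 0 :=
  le_antisymm ((inf_add_le_of_nonneg hx hy hz).trans (by simp [hzx, hzy]))
    (le_inf hz (add_nonneg hx hy))

lemma inf_nsmul_eq_zero {x z : G} (hx : 0 ≤ x) (hz : 0 ≤ z) (h : z ⊓ x = 0) (n : ℕ) :
    z ⊓ n • x = 0 := by
  induction n with
  | zero => simpa using hz
  | succ k ih =>
    rw [succ_nsmul]
    exact inf_add_eq_zero (nsmul_nonneg hx k) hx hz ih h

lemma le_of_le_add_of_inf_eq_zero {x y z : G} (hx : 0 ≤ x) (hy : 0 ≤ y) (hz : 0 ≤ z)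
    (h : z ⊓ y = 0) (hle : z ≤ x + y) : z ≤ x :=
  calc z ≤ z ⊓ (x + y) := le_inf le_rfl hle
    _ ≤ z ⊓ x + z ⊓ y := inf_add_le_of_nonneg hx hy hz
    _ ≤ x := by rw [h, add_zero]; exact inf_le_right

lemma nsmul_posPart_le {v z : G} {n : ℕ} (hz : 0 ≤ z) (h : n • v ≤ z) : n • v⁺ ≤ z := by
  refine le_of_le_add_of_inf_eq_zero hz (nsmul_nonneg (negPart_nonneg v) n)
    (nsmul_nonneg (posPart_nonneg v) n) ?_ ?_
  · refine inf_nsmul_eq_zero (negPart_nonneg v) (nsmul_nonneg (posPart_nonneg v) n) ?_ n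
    rw [inf_comm]
    refine inf_nsmul_eq_zero (posPart_nonneg v) (negPart_nonneg v) ?_ n
    rw [inf_comm, posPart_inf_negPart_eq_zero]
  · rw [← sub_le_iff_le_add, ← nsmul_sub, posPart_sub_negPart]
    exact h

lemma nsmul_negPart_le {v z : G} {n : ℕ} (hz : 0 ≤ z) (h : n • -v ≤ z) : n • v⁻ ≤ z := by
  rw [← posPart_neg]
  exact nsmul_posPart_le hz h

lemma nonpos_of_nsmul_nonpos {x : G} {n : ℕ} (hn : n ≠ 0) (h : n • x ≤ 0) : x ≤ 0 := by
  rw [← posPart_nonpos]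
  exact (le_self_nsmul (posPart_nonneg x) hn).trans (nsmul_posPart_le le_rfl h)

lemma le_of_nsmul_le_nsmul_of_ne_zero {x y : G} {n : ℕ} (hn : n ≠ 0) (h : n • x ≤ n • y) :
    x ≤ y := by
  rw [← sub_nonpos] at h ⊢
  rw [← nsmul_sub] at h
  exact nonpos_of_nsmul_nonpos hn h

lemma nsmul_sup_le (x y : G) (n : ℕ) : n • (x ⊔ y) ≤ n • x ⊔ n • y := by
  rw [sup_eq_add_posPart_sub x y, sup_eq_add_posPart_sub (n • x), nsmul_add]
  gcongr
  refine nsmul_posPart_le (posPart_nonneg _) ?_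
  rw [nsmul_sub]
  exact le_posPart _

lemma nonpos_of_forall_nsmul_le (hDC : DedekindComplete G) {w v : G}
    (h : ∀ n : ℕ, n ≠ 0 → n • w ≤ v) : w ≤ 0 := by
  obtain ⟨u, hu⟩ := hDC (Set.range fun n : ℕ => (n + 1) • w) (Set.range_nonempty _)
    ⟨v, by rintro _ ⟨n, rfl⟩; exact h _ n.succ_ne_zero⟩
  have : u ≤ u - w := hu.2 <| by
    rintro _ ⟨n, rfl⟩
    rw [le_sub_iff_add_le, ← succ_nsmul]
    exact hu.1 ⟨n + 1, rfl⟩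
  simpa using this

lemma eq_zero_of_inf_posPart_of_inf_negPart {w v : G} (hw : 0 ≤ w) (hp : w ⊓ v⁺ = 0)
    (hn : w ⊓ v⁻ = 0) : w ⊓ |v| = 0 := by
  rw [← posPart_add_negPart]
  exact inf_add_eq_zero (posPart_nonneg v) (negPart_nonneg v) hw hp hn

lemma posPart_le_abs_self (v : G) : v⁺ ≤ |v| := sup_le (le_abs_self v) (abs_nonneg v)

lemma negPart_le_abs_self (v : G) : v⁻ ≤ |v| := sup_le (neg_le_abs v) (abs_nonneg v)

lemma negPart_add_sub_le {a p q : G} (h : q⁺ ⊓ p⁻ = 0) :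
    -(a + p - q) ≤ (p⁻ ⊔ (a - q)⁻) + a⁻ := by
  have hsum : q - p ≤ q⁺ ⊔ p⁻ := by
    rw [← add_zero (q⁺ ⊔ p⁻), ← h, add_comm, inf_add_sup, sub_eq_add_neg]
    exact add_le_add (le_posPart q) (neg_le_negPart p)
  calc -(a + p - q) = (q - p) + -a := by abel
    _ ≤ (q⁺ ⊔ p⁻) + -a := by gcongr
    _ ≤ _ := by
      rw [posPart_def, sup_add, sup_add, zero_add]
      refine sup_le (sup_le ?_ ?_) ?_
      · refine le_add_of_le_of_nonneg (le_sup_of_le_right ?_) (negPart_nonneg a)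
        refine le_trans (le_of_eq (by abel)) (neg_le_negPart (a - q))
      · exact le_add_of_nonneg_of_le (le_sup_of_le_left (negPart_nonneg p)) (neg_le_negPart a)
      · exact add_le_add le_sup_left (neg_le_negPart a)

lemma abs_mem_Icc {x y : G} (h : |y| ≤ x) : y ∈ Set.Icc (-x) x :=
  ⟨neg_le.1 ((neg_le_abs y).trans h), (le_abs_self y).trans h⟩

lemma abs_inf_abs_eq_zero_of_add {x y z : G} (hx : |x| ⊓ |z| = 0) (hy : |y| ⊓ |z| = 0) :
    |x + y| ⊓ |z| = 0 := by
  refine inf_eq_zero_of_le (abs_nonneg _) (abs_nonneg _) (abs_add_le x y) le_rfl ?_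
  rw [inf_comm] at hx hy ⊢
  exact inf_add_eq_zero (abs_nonneg _) (abs_nonneg _) (abs_nonneg _) hx hy

end LatticeOrderedGroup

lemma exists_nsmul_eq {E : Type*} [AddCommGroup E] [Module ℝ E] (c : E) {n : ℕ} (hn : n ≠ 0) :
    ∃ d : E, n • d = c :=
  ⟨(n : ℝ)⁻¹ • c, by
    rw [← Nat.cast_smul_eq_nsmul ℝ, smul_inv_smul₀ (Nat.cast_ne_zero.2 hn)]⟩

lemma IsOrthomorphism.abs_inf_abs {E : Type*} [Lattice E] [AddCommGroup E] [Module ℝ E]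
    {R : Module.End ℝ E} (hR : IsOrthomorphism R) {x y : E} (h : |x| ⊓ |y| = 0) :
    |R x| ⊓ |R y| = 0 := by
  have := hR.2 x y h
  rw [inf_comm] at this ⊢
  exact hR.2 y _ this

section Orthomorphism

variable {E : Type*} [Lattice E] [AddCommGroup E] [CovariantClass E E (· + ·) (· ≤ ·)]
  [Module ℝ E]

lemma IsOrderBoundedMap.comp {f g : E →ₗ[ℝ] E} (hf : IsOrderBoundedMap f)
    (hg : IsOrderBoundedMap g) : IsOrderBoundedMap (f.comp g) := by
  intro x hx
  obtain ⟨b, hb⟩ := hg x hx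
  obtain ⟨c, hc⟩ := hf b ((abs_nonneg _).trans (hb 0 ⟨neg_nonpos.2 hx, hx⟩))
  exact ⟨c, fun y hy => hc _ (abs_mem_Icc (hb y hy))⟩

lemma abs_apply_le_of_dominated {f g : E →ₗ[ℝ] E} (h : ∀ x, 0 ≤ x → |f x| ≤ g x) (z : E) :
    |f z| ≤ g |z| := by
  rw [← posPart_add_negPart z, map_add]
  nth_rw 1 [← posPart_sub_negPart z]
  rw [map_sub, sub_eq_add_neg]
  refine (abs_add_le _ _).trans (add_le_add (h _ (posPart_nonneg z)) ?_)
  rw [abs_neg]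
  exact h _ (negPart_nonneg z)

lemma apply_le_apply_of_nonneg {f : E →ₗ[ℝ] E} (hf : ∀ x, 0 ≤ x → 0 ≤ f x) {x y : E}
    (h : x ≤ y) : f x ≤ f y := by
  rw [← sub_nonneg, ← map_sub]
  exact hf _ (sub_nonneg.2 h)

lemma isOrderBoundedMap_of_nonneg {f : E →ₗ[ℝ] E} (hf : ∀ x, 0 ≤ x → 0 ≤ f x) :
    IsOrderBoundedMap f := fun x _ => by
  refine ⟨f x, fun y hy => abs_le'.2 ⟨apply_le_apply_of_nonneg hf hy.2, ?_⟩⟩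
  rw [← map_neg]
  exact apply_le_apply_of_nonneg hf (neg_le.1 hy.1)

variable (E) in
/-- The orthomorphisms form a subring of the ring of endomorphisms. -/
def orthomorphismSubring : Subring (Module.End ℝ E) where
  carrier := {f | IsOrthomorphism f}
  mul_mem' := fun hf hg => ⟨hf.1.comp hg.1, fun x y h => hf.2 _ y (hg.2 x y h)⟩
  one_mem' := ⟨isOrderBoundedMap_of_nonneg fun _ h => h, fun _ _ h => h⟩
  add_mem' := by
    rintro f g ⟨hf, hf'⟩ ⟨hg, hg'⟩
    refine ⟨fun x hx => ?_, fun x y h => abs_inf_abs_eq_zero_of_add (hf' x y h) (hg' x y h)⟩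
    obtain ⟨b, hb⟩ := hf x hx
    obtain ⟨c, hc⟩ := hg x hx
    exact ⟨b + c, fun y hy => (abs_add_le _ _).trans (add_le_add (hb y hy) (hc y hy))⟩
  zero_mem' := by
    refine ⟨isOrderBoundedMap_of_nonneg fun _ _ => le_rfl, fun x y _ => ?_⟩
    simp
  neg_mem' := by
    rintro f ⟨hf, hf'⟩
    exact ⟨fun x hx => (hf x hx).imp fun b hb y hy => by
      rw [LinearMap.neg_apply, abs_neg]; exact hb y hy,
      fun x y h => by rw [LinearMap.neg_apply, abs_neg]; exact hf' x y h⟩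

namespace IsOrthomorphism

variable {R : Module.End ℝ E}

lemma neg (hR : IsOrthomorphism R) : IsOrthomorphism (-R) :=
  (orthomorphismSubring E).neg_mem hR

lemma nsmul_negPart_inf_le (hR : IsOrthomorphism R) {u M b : E} (hb : 0 ≤ b)
    (hbu : b ⊓ (R u)⁻ = 0) (hM : ∀ s ∈ Set.Icc (-u) u, |R s| ≤ M) (k : ℕ) :
    ∀ y ∈ Set.Icc 0 u, b ⊓ 2 ^ k • (R y)⁻ ≤ M := by
  induction k with
  | zero =>
    rintro y ⟨hy, hyu⟩
    rw [pow_zero, one_nsmul]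
    exact inf_le_right.trans ((negPart_le_abs_self _).trans
      (hM y ⟨(neg_nonpos.2 (hy.trans hyu)).trans hy, hyu⟩))
  | succ k ih =>
    rintro y ⟨hy, hyu⟩
    set p := (y + y - u)⁺
    set q := (y + y - u)⁻
    have hu : 0 ≤ u := hy.trans hyu
    have hpq : p - q = y + y - u := posPart_sub_negPart _
    have hpu : p ≤ u := sup_le (by rw [sub_le_iff_le_add]; exact add_le_add hyu hyu) hu
    have hqu : q ≤ u := by
      refine sup_le ?_ hu
      rw [neg_sub]
      exact sub_le_self u (add_nonneg hy hy)
    have hdisj : |R q| ⊓ |R p| = 0 := by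
      refine hR.abs_inf_abs ?_
      rw [abs_of_nonneg (negPart_nonneg _), abs_of_nonneg (posPart_nonneg _), inf_comm]
      exact posPart_inf_negPart_eq_zero _
    have hRy : R u + R p - R q = 2 • R y := by
      rw [← map_add, ← map_sub, add_sub_assoc, hpq, ← map_nsmul]
      congr 1
      abel
    have hkey : 2 • (R y)⁻ ≤ ((R p)⁻ ⊔ (R (u - q))⁻) + (R u)⁻ := by
      refine nsmul_negPart_le
        (add_nonneg (le_sup_of_le_left (negPart_nonneg _)) (negPart_nonneg _)) ?_
      rw [smul_neg, ← hRy, map_sub]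
      refine negPart_add_sub_le (inf_eq_zero_of_le (posPart_nonneg _) (negPart_nonneg _)
        (posPart_le_abs_self _) (negPart_le_abs_self _) hdisj)
    have hm : (0 : E) ≤ (R p)⁻ ⊔ (R (u - q))⁻ := le_sup_of_le_left (negPart_nonneg _)
    calc b ⊓ 2 ^ (k + 1) • (R y)⁻ = b ⊓ 2 ^ k • 2 • (R y)⁻ := by rw [pow_succ, mul_nsmul']
      _ ≤ b ⊓ (2 ^ k • ((R p)⁻ ⊔ (R (u - q))⁻) + 2 ^ k • (R u)⁻) := by
        rw [← nsmul_add]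
        exact inf_le_inf_left _ (nsmul_le_nsmul_right hkey _)
      _ ≤ b ⊓ 2 ^ k • ((R p)⁻ ⊔ (R (u - q))⁻) + b ⊓ 2 ^ k • (R u)⁻ :=
        inf_add_le_of_nonneg (nsmul_nonneg hm _) (nsmul_nonneg (negPart_nonneg _) _) hb
      _ = b ⊓ 2 ^ k • ((R p)⁻ ⊔ (R (u - q))⁻) := by
        rw [inf_nsmul_eq_zero (negPart_nonneg _) hb hbu, add_zero]
      _ ≤ b ⊓ (2 ^ k • (R p)⁻ ⊔ 2 ^ k • (R (u - q))⁻) :=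
        inf_le_inf_left _ (nsmul_sup_le _ _ _)
      _ ≤ M := by
        let _ : DistribLattice E := AddCommGroup.toDistribLattice E
        rw [inf_sup_left]
        exact sup_le (ih p ⟨posPart_nonneg _, hpu⟩)
          (ih (u - q) ⟨sub_nonneg.2 hqu, sub_le_self _ (negPart_nonneg _)⟩)

lemma posPart_inf_negPart_of_le (hDC : DedekindComplete E) (hR : IsOrthomorphism R) {y u : E}
    (hy : 0 ≤ y) (hyu : y ≤ u) : (R u)⁺ ⊓ (R y)⁻ = 0 := by
  obtain ⟨M, hM⟩ := hR.1 u (hy.trans hyu)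
  have hw : 0 ≤ (R u)⁺ ⊓ (R y)⁻ := le_inf (posPart_nonneg _) (negPart_nonneg _)
  refine le_antisymm (nonpos_of_forall_nsmul_le hDC (v := M) fun n _ => ?_) hw
  calc n • ((R u)⁺ ⊓ (R y)⁻) ≤ 2 ^ n • ((R u)⁺ ⊓ (R y)⁻) :=
        nsmul_le_nsmul_left hw Nat.lt_two_pow_self.le
    _ ≤ 2 ^ n • (R u)⁺ ⊓ 2 ^ n • (R y)⁻ :=
        le_inf (nsmul_le_nsmul_right inf_le_left _) (nsmul_le_nsmul_right inf_le_right _)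
    _ ≤ M := by
      refine hR.nsmul_negPart_inf_le (nsmul_nonneg (posPart_nonneg _) _) ?_ hM n y ⟨hy, hyu⟩
      rw [inf_comm]
      refine inf_nsmul_eq_zero (posPart_nonneg _) (negPart_nonneg _) ?_ _
      rw [inf_comm]
      exact posPart_inf_negPart_eq_zero _

lemma posPart_inf_negPart (hDC : DedekindComplete E) (hR : IsOrthomorphism R) {x y : E}
    (hx : 0 ≤ x) (hy : 0 ≤ y) : (R x)⁺ ⊓ (R y)⁻ = 0 := by
  set w := (R x)⁺ ⊓ (R y)⁻
  have hw : 0 ≤ w := le_inf (posPart_nonneg _) (negPart_nonneg _)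
  have hdisj : ∀ u, x ≤ u → y ≤ u → w ⊓ |R u| = 0 := by
    intro u hxu hyu
    refine eq_zero_of_inf_posPart_of_inf_negPart hw ?_ ?_
    · rw [inf_comm]
      exact inf_eq_zero_of_le (posPart_nonneg _) hw le_rfl inf_le_right
        (hR.posPart_inf_negPart_of_le hDC hy hyu)
    · have := hR.neg.posPart_inf_negPart_of_le hDC hx hxu
      rw [LinearMap.neg_apply, LinearMap.neg_apply, posPart_neg, negPart_neg] at this
      rw [inf_comm]
      exact inf_eq_zero_of_le (negPart_nonneg _) hw le_rfl inf_le_left this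
  have h1 := hdisj (x + y) (le_add_of_nonneg_right hy) (le_add_of_nonneg_left hx)
  have h2 := hdisj (x + (x + y)) (le_add_of_nonneg_right (add_nonneg hx hy))
    (le_add_of_nonneg_of_le hx (le_add_of_nonneg_left hx))
  have h3 : w ≤ |R (x + (x + y))| + |R (x + y)| := by
    have : R x = R (x + (x + y)) + -R (x + y) := by rw [map_add R x (x + y)]; abel
    calc w ≤ |R x| := inf_le_left.trans (posPart_le_abs_self _)
      _ ≤ _ := by
        rw [this]
        refine (abs_add_le _ _).trans ?_
        rw [abs_neg]
  have h4 := inf_add_eq_zero (abs_nonneg _) (abs_nonneg _) hw h2 h1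
  rwa [inf_eq_left.2 h3] at h4

lemma apply_posPart_nonneg (hDC : DedekindComplete E) (hR : IsOrthomorphism R) {x : E}
    (hx : 0 ≤ x) : 0 ≤ R (R x)⁺ := by
  have h := hR.posPart_inf_negPart hDC hx (posPart_nonneg (R x))
  have h' := hR.2 (R x)⁺ (R (R x)⁺)⁻
    (by rwa [abs_of_nonneg (posPart_nonneg _), abs_of_nonneg (negPart_nonneg _)])
  rw [abs_of_nonneg (negPart_nonneg _)] at h'
  exact negPart_eq_zero.1 (le_antisymm ((le_inf (negPart_le_abs_self _) le_rfl).trans h'.le)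
    (negPart_nonneg _))

lemma apply_apply_nonneg (hDC : DedekindComplete E) (hR : IsOrthomorphism R) {x : E}
    (hx : 0 ≤ x) : 0 ≤ R (R x) := by
  have h := hR.neg.apply_posPart_nonneg hDC hx
  rw [LinearMap.neg_apply, LinearMap.neg_apply, posPart_neg] at h
  rw [← posPart_sub_negPart (R x), map_sub, sub_eq_add_neg]
  exact add_nonneg (hR.apply_posPart_nonneg hDC hx) h

lemma natCast_sub (hR : IsOrthomorphism R) (n : ℕ) :
    IsOrthomorphism ((n : Module.End ℝ E) - R) :=
  (orthomorphismSubring E).sub_mem (natCast_mem _ n) hR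

lemma nsmul_apply_le (hDC : DedekindComplete E) (hR : IsOrthomorphism R) {x : E} (hx : 0 ≤ x)
    (n : ℕ) : (2 * n) • R x ≤ (n * n) • x + R (R x) := by
  have h := (hR.natCast_sub n).apply_apply_nonneg hDC hx
  simp only [LinearMap.sub_apply, Module.End.natCast_apply, map_sub, map_nsmul] at h
  rw [← sub_nonneg]
  refine h.trans_eq ?_
  rw [nsmul_sub, two_mul, add_nsmul, mul_nsmul]
  abel

lemma one_add_mul_self (hR : IsOrthomorphism R) : IsOrthomorphism (1 + R * R) :=
  (orthomorphismSubring E).add_mem (one_mem _) ((orthomorphismSubring E).mul_mem hR hR)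

lemma le_one_add_mul_self_apply (hDC : DedekindComplete E) (hR : IsOrthomorphism R) {x : E}
    (hx : 0 ≤ x) : x ≤ (1 + R * R) x :=
  le_add_of_nonneg_right (hR.apply_apply_nonneg hDC hx)

lemma apply_le_one_add_mul_self_apply (hDC : DedekindComplete E) (hR : IsOrthomorphism R) {x : E}
    (hx : 0 ≤ x) : R x ≤ (1 + R * R) x := by
  refine le_of_nsmul_le_nsmul_of_ne_zero two_ne_zero ?_
  have h := hR.nsmul_apply_le hDC hx 1
  rw [mul_one, mul_one, one_nsmul] at h
  refine h.trans ?_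
  rw [two_nsmul]
  exact le_add_of_nonneg_right (hx.trans (hR.le_one_add_mul_self_apply hDC hx))

lemma abs_apply_le_one_add_mul_self_apply (hDC : DedekindComplete E) (hR : IsOrthomorphism R)
    {x : E} (hx : 0 ≤ x) : |R x| ≤ (1 + R * R) x := by
  refine abs_le'.2 ⟨hR.apply_le_one_add_mul_self_apply hDC hx, ?_⟩
  have h := hR.neg.apply_le_one_add_mul_self_apply hDC hx
  rwa [neg_mul_neg] at h

lemma nonneg_of_apply_nonneg (hR : IsOrthomorphism R) (h1 : ∀ x, 0 ≤ x → x ≤ R x) {x : E}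
    (hx : 0 ≤ R x) : 0 ≤ x := by
  have hdisj := hR.2 x⁺ x⁻ (by
    rw [abs_of_nonneg (posPart_nonneg _), abs_of_nonneg (negPart_nonneg _)]
    exact posPart_inf_negPart_eq_zero x)
  rw [abs_of_nonneg (negPart_nonneg x)] at hdisj
  have hle : x⁻ ≤ R x⁺ := by
    refine (h1 _ (negPart_nonneg x)).trans ?_
    rwa [← sub_nonneg, ← map_sub, posPart_sub_negPart]
  exact negPart_eq_zero.1 (le_antisymm
    ((le_inf (hle.trans (le_abs_self _)) le_rfl).trans hdisj.le) (negPart_nonneg x))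

/-- Positive orthomorphisms are order continuous. -/
lemma apply_le_of_isLUB (hDC : DedekindComplete E) (hR : IsOrthomorphism R)
    (hpos : ∀ x, 0 ≤ x → 0 ≤ R x) {A : Set E} {l s y : E} (hl : l ∈ lowerBounds A)
    (hs : IsLUB A s) (hy : ∀ a ∈ A, R a ≤ y) : R s ≤ y := by
  rw [← sub_nonpos]
  refine nonpos_of_nsmul_nonpos two_ne_zero ?_
  refine nonpos_of_forall_nsmul_le hDC (v := R (R (s - l))) fun n hn => ?_
  have hnn : n * n ≠ 0 := mul_ne_zero hn hn
  obtain ⟨d, hd⟩ := exists_nsmul_eq (n • 2 • (R s - y) - R (R (s - l))) hnn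
  have hub : s ≤ s - d := hs.2 fun a ha => by
    rw [le_sub_comm]
    refine le_of_nsmul_le_nsmul_of_ne_zero hnn ?_
    rw [hd, sub_le_iff_le_add]
    calc n • 2 • (R s - y) ≤ n • 2 • R (s - a) := by
          rw [map_sub]
          gcongr
          exact hy a ha
      _ = (2 * n) • R (s - a) := by rw [mul_nsmul]
      _ ≤ (n * n) • (s - a) + R (R (s - a)) :=
          hR.nsmul_apply_le hDC (sub_nonneg.2 (hs.1 ha)) n
      _ ≤ (n * n) • (s - a) + R (R (s - l)) := by
          gcongr
          exact apply_le_apply_of_nonneg hpos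
            (apply_le_apply_of_nonneg hpos (sub_le_sub_left (hl ha) s))
  have hd0 : d ≤ 0 := by simpa using hub
  rw [← sub_nonpos, ← hd]
  exact nsmul_nonpos hd0 _

lemma surjective (hDC : DedekindComplete E) (hR : IsOrthomorphism R)
    (h1 : ∀ x, 0 ≤ x → x ≤ R x) : Function.Surjective R := by
  have hpos : ∀ x, 0 ≤ x → 0 ≤ R x := fun x hx => hx.trans (h1 x hx)
  suffices h : ∀ y, 0 ≤ y → ∃ x, R x = y by
    intro y
    obtain ⟨a, ha⟩ := h y⁺ (posPart_nonneg y)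
    obtain ⟨b, hb⟩ := h y⁻ (negPart_nonneg y)
    exact ⟨a - b, by rw [map_sub, ha, hb, posPart_sub_negPart]⟩
  intro y hy
  set A : Set E := {x | 0 ≤ x ∧ R x ≤ y}
  have h0 : (0 : E) ∈ A := ⟨le_rfl, by rwa [map_zero]⟩
  obtain ⟨s, hs⟩ := hDC A ⟨0, h0⟩ ⟨y, fun x hx => (h1 x hx.1).trans hx.2⟩
  have hsy : R s ≤ y :=
    hR.apply_le_of_isLUB hDC hpos (fun a ha => ha.1) hs fun a ha => ha.2
  refine ⟨s, le_antisymm hsy ?_⟩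
  set z := y - R s
  have hz0 : 0 ≤ z := sub_nonneg.2 hsy
  rw [← sub_nonpos]
  refine nonpos_of_forall_nsmul_le hDC (v := R z) fun n hn => ?_
  have hnn : n * n ≠ 0 := mul_ne_zero hn hn
  set h := (n • z - R z)⁺
  obtain ⟨d, hd⟩ := exists_nsmul_eq h hnn
  have hRh : R h ≤ n • h := by
    have := (hR.natCast_sub n).apply_posPart_nonneg hDC hz0
    simpa only [LinearMap.sub_apply, Module.End.natCast_apply, sub_nonneg] using this
  have hhz : h ≤ n • z := sup_le (sub_le_self _ (hpos z hz0)) (nsmul_nonneg hz0 n)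
  have hd0 : 0 ≤ d := le_of_nsmul_le_nsmul_of_ne_zero hnn (by
    rw [hd, nsmul_zero]; exact posPart_nonneg _)
  have hRd : R d ≤ z := le_of_nsmul_le_nsmul_of_ne_zero hnn (by
    rw [← map_nsmul, hd, mul_nsmul]
    exact hRh.trans (nsmul_le_nsmul_right hhz n))
  have hmem : s + d ∈ A := by
    refine ⟨add_nonneg (hs.1 h0) hd0, ?_⟩
    rw [map_add, ← le_sub_iff_add_le']
    exact hRd
  have hd1 : d ≤ 0 := by simpa using hs.1 hmem
  have hh0 : h ≤ 0 := by
    rw [← hd]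
    exact nsmul_nonpos hd1 _
  exact sub_nonpos.1 ((le_posPart _).trans hh0)

/-- In a Dedekind complete vector lattice, an orthomorphism above the identity has a positive
inverse. -/
lemma exists_inverse (hDC : DedekindComplete E) (hR : IsOrthomorphism R)
    (h1 : ∀ x, 0 ≤ x → x ≤ R x) :
    ∃ R' : Module.End ℝ E, R' * R = 1 ∧ R * R' = 1 ∧ ∀ x, 0 ≤ x → 0 ≤ R' x := by
  have hinj : Function.Injective R := by
    rw [injective_iff_map_eq_zero]
    intro x hx
    refine le_antisymm ?_ (hR.nonneg_of_apply_nonneg h1 hx.ge)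
    rw [← neg_nonneg]
    exact hR.nonneg_of_apply_nonneg h1 (by rw [map_neg, hx, neg_zero])
  let e := LinearEquiv.ofBijective R ⟨hinj, hR.surjective hDC h1⟩
  refine ⟨e.symm, LinearMap.ext e.symm_apply_apply, LinearMap.ext e.apply_symm_apply,
    fun x hx => hR.nonneg_of_apply_nonneg h1 ?_⟩
  exact hx.trans_eq (e.apply_symm_apply x).symm

end IsOrthomorphism

section IsLobLattice

variable {𝕃 : Type*} [Lattice 𝕃] [AddCommGroup 𝕃] [Module ℝ 𝕃] {j : 𝕃 →ₗ[ℝ] E →ₗ[ℝ] E}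

/-- An invertible transformation of `L_ob(E)` that is positive together with its inverse is an
order automorphism. -/
lemma IsLobLattice.exists_orderIso (hj : IsLobLattice E 𝕃 j)
    (e : (E →ₗ[ℝ] E) ≃ (E →ₗ[ℝ] E))
    (he : ∀ f, IsOrderBoundedMap f → IsOrderBoundedMap (e f))
    (he' : ∀ f, IsOrderBoundedMap f → IsOrderBoundedMap (e.symm f))
    (hm : ∀ f g : E →ₗ[ℝ] E, (∀ x, 0 ≤ x → f x ≤ g x) → ∀ x, 0 ≤ x → e f x ≤ e g x)
    (hm' : ∀ f g : E →ₗ[ℝ] E, (∀ x, 0 ≤ x → f x ≤ g x) →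
      ∀ x, 0 ≤ x → e.symm f x ≤ e.symm g x) :
    ∃ φ : 𝕃 ≃o 𝕃, ∀ S, j (φ S) = e (j S) := by
  have hbdd : ∀ S, IsOrderBoundedMap (j S) := fun S => (hj.mem_range_iff _).1 ⟨S, rfl⟩
  choose L hL using fun S => (hj.mem_range_iff _).2 (he _ (hbdd S))
  choose L' hL' using fun S => (hj.mem_range_iff _).2 (he' _ (hbdd S))
  let ψ : 𝕃 ≃ 𝕃 :=
    { toFun := L
      invFun := L'
      left_inv := fun S => hj.inj (by rw [hL', hL, e.symm_apply_apply])
      right_inv := fun S => hj.inj (by rw [hL, hL', e.apply_symm_apply]) }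
  refine ⟨ψ.toOrderIso (fun S U h => ?_) (fun S U h => ?_), hL⟩
  · change L S ≤ L U
    rw [hj.le_iff, hL, hL]
    exact hm _ _ ((hj.le_iff _ _).1 h)
  · change L' S ≤ L' U
    rw [hj.le_iff, hL', hL']
    exact hm' _ _ ((hj.le_iff _ _).1 h)

lemma IsLobLattice.abs_apply_le (hj : IsLobLattice E 𝕃 j) (S : 𝕃) {x : E} (hx : 0 ≤ x) :
    |j S x| ≤ j |S| x := by
  refine abs_le'.2 ⟨(hj.le_iff _ _).1 (le_abs_self S) x hx, ?_⟩
  rw [← LinearMap.neg_apply, ← map_neg]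
  exact (hj.le_iff _ _).1 (neg_le_abs S) x hx

lemma IsLobLattice.abs_le_of_abs_apply_le (hj : IsLobLattice E 𝕃 j) {S U : 𝕃}
    (h : ∀ x, 0 ≤ x → |j S x| ≤ j U x) : |S| ≤ U := by
  refine abs_le'.2 ⟨(hj.le_iff _ _).2 fun x hx => (le_abs_self _).trans (h x hx),
    (hj.le_iff _ _).2 fun x hx => ?_⟩
  rw [map_neg]
  exact (neg_le_abs _).trans (h x hx)

end IsLobLattice

end Orthomorphism

/-- Unbounded order convergence to `0` passes to a net dominated by the image of the original
net under an order automorphism that fixes `0` and lies above the identity on the positive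
cone. -/
lemma UOTendsto.of_abs_le_orderIso {F ι : Type*} [Lattice F] [AddCommGroup F]
    [CovariantClass F F (· + ·) (· ≤ ·)] [Preorder ι] {S C : ι → F} (hS : UOTendsto S 0)
    (φ : F ≃o F) (hφ0 : φ 0 = 0) (hφ : ∀ U, 0 ≤ U → U ≤ φ U) (hC : ∀ a, |C a| ≤ φ |S a|) :
    UOTendsto C 0 := by
  intro U hU
  obtain ⟨D, hne, hdir, hglb, hD⟩ := hS U hU
  refine ⟨φ '' D, hne.image φ, ?_, ?_, ?_⟩
  · rintro _ ⟨a, ha, rfl⟩ _ ⟨b, hb, rfl⟩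
    obtain ⟨c, hc, hca, hcb⟩ := hdir a ha b hb
    exact ⟨φ c, ⟨c, hc, rfl⟩, φ.monotone hca, φ.monotone hcb⟩
  · rw [← hφ0]
    exact φ.isGLB_image'.2 hglb
  · rintro _ ⟨d, hd, rfl⟩
    obtain ⟨a₀, ha₀⟩ := hD d hd
    refine ⟨a₀, fun a ha => ?_⟩
    have h := (le_abs_self _).trans (ha₀ a ha)
    simp only [sub_zero] at h ⊢
    rw [abs_of_nonneg (le_inf (abs_nonneg _) hU)]
    calc |C a| ⊓ U ≤ φ |S a| ⊓ φ U := inf_le_inf (hC a) (hφ U hU)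
      _ = φ (|S a| ⊓ U) := (φ.map_inf _ _).symm
      _ ≤ φ d := φ.monotone h

/-- For a Dedekind complete vector lattice `E` and an orthomorphism
`T` on `E`, both the right multiplication `ρ_T` and the left multiplication `λ_T` on
`L_ob(E)` are uo-uo continuous.  Here `(𝕃, j)` realizes `L_ob(E)`. -/
theorem stmt5 {E 𝕃 : Type*}
    [Lattice E] [AddCommGroup E] [CovariantClass E E (· + ·) (· ≤ ·)] [Module ℝ E]
    [Lattice 𝕃] [AddCommGroup 𝕃] [CovariantClass 𝕃 𝕃 (· + ·) (· ≤ ·)] [Module ℝ 𝕃]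
    (j : 𝕃 →ₗ[ℝ] E →ₗ[ℝ] E) (hj : IsLobLattice E 𝕃 j)
    (hDC : DedekindComplete E)
    (T : 𝕃) (hT : IsOrthomorphism (j T)) {ι : Type*} [Preorder ι]
    (S : ι → 𝕃) (hS : UOTendsto S (0 : 𝕃))
    (CR CL : ι → 𝕃)
    (hCR : ∀ a : ι, j (CR a) = (j (S a)).comp (j T))
    (hCL : ∀ a : ι, j (CL a) = (j T).comp (j (S a))) :
    UOTendsto CR (0 : 𝕃) ∧ UOTendsto CL (0 : 𝕃) := by
  have hTT := hT.one_add_mul_self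
  have h1 : ∀ x, 0 ≤ x → x ≤ (1 + j T * j T) x :=
    fun x hx => hT.le_one_add_mul_self_apply hDC hx
  have hTQ : ∀ x, 0 ≤ x → |j T x| ≤ (1 + j T * j T) x :=
    fun x hx => hT.abs_apply_le_one_add_mul_self_apply hDC hx
  obtain ⟨Q', hl, hr, hpos'⟩ := hTT.exists_inverse hDC h1
  generalize (1 + j T * j T : Module.End ℝ E) = Q at *
  have hpos : ∀ x, 0 ≤ x → 0 ≤ Q x := fun x hx => hx.trans (h1 x hx)
  have hQ : IsOrderBoundedMap Q := isOrderBoundedMap_of_nonneg hpos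
  have hQ' : IsOrderBoundedMap Q' := isOrderBoundedMap_of_nonneg hpos'
  have hj_nonneg : ∀ U : 𝕃, 0 ≤ U → ∀ x, 0 ≤ x → 0 ≤ j U x := fun U hU x hx => by
    simpa using (hj.le_iff 0 U).1 hU x hx
  constructor
  · let e : Module.End ℝ E ≃ Module.End ℝ E :=
      { toFun := fun f => f * Q
        invFun := fun f => f * Q'
        left_inv := fun f => by simp only [mul_assoc, hr, mul_one]
        right_inv := fun f => by simp only [mul_assoc, hl, mul_one] }
    obtain ⟨φ, hφ⟩ := hj.exists_orderIso e (fun f hf => hf.comp hQ) (fun f hf => hf.comp hQ')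
      (fun f g h x hx => h _ (hpos x hx)) (fun f g h x hx => h _ (hpos' x hx))
    have hφ' : ∀ S x, j (φ S) x = j S (Q x) := fun S x => by rw [hφ]; rfl
    refine hS.of_abs_le_orderIso φ (hj.inj ?_) (fun U hU => (hj.le_iff _ _).2 fun x hx => ?_)
      fun a => hj.abs_le_of_abs_apply_le fun x hx => ?_
    · ext x
      simp [hφ']
    · rw [hφ']
      exact apply_le_apply_of_nonneg (hj_nonneg U hU) (h1 x hx)
    · rw [hφ', hCR, LinearMap.comp_apply]
      exact (abs_apply_le_of_dominated (fun _ => hj.abs_apply_le (S a)) _).trans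
        (apply_le_apply_of_nonneg (hj_nonneg _ (abs_nonneg _)) (hTQ x hx))
  · let e : Module.End ℝ E ≃ Module.End ℝ E :=
      { toFun := fun f => Q * f
        invFun := fun f => Q' * f
        left_inv := fun f => by simp only [← mul_assoc, hl, one_mul]
        right_inv := fun f => by simp only [← mul_assoc, hr, one_mul] }
    obtain ⟨φ, hφ⟩ := hj.exists_orderIso e (fun f hf => hQ.comp hf) (fun f hf => hQ'.comp hf)
      (fun f g h x hx => apply_le_apply_of_nonneg hpos (h x hx))
      (fun f g h x hx => apply_le_apply_of_nonneg hpos' (h x hx))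
    have hφ' : ∀ S x, j (φ S) x = Q (j S x) := fun S x => by rw [hφ]; rfl
    refine hS.of_abs_le_orderIso φ (hj.inj ?_) (fun U hU => (hj.le_iff _ _).2 fun x hx => ?_)
      fun a => hj.abs_le_of_abs_apply_le fun x hx => ?_
    · ext x
      simp [hφ']
    · rw [hφ']
      exact h1 _ (hj_nonneg U hU x hx)
    · rw [hφ', hCL, LinearMap.comp_apply]
      exact (abs_apply_le_of_dominated hTQ _).trans
        (apply_le_apply_of_nonneg hpos (hj.abs_apply_le (S a) hx))
end

section
/- Let E be a Dedekind complete vector lattice. Suppose (S_α) is a net in Orth(E) strongly order convergent to some S ∈ L_ob(E), and (T_β) is a net in L_ob(E) strongly order convergent to some T ∈ L_ob(E). Then S ∈ Orth(E) and the net (S_α T_β) is strongly order convergent to S T in L_ob(E). -/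
open Filter

theorem Module.exists_add_self_eq {E : Type*} [AddCommGroup E] [Module ℝ E] (x : E) : ∃ e : E, e + e = x :=
  ⟨(1 / 2 : ℝ) • x, by rw [← add_smul]; norm_num⟩

theorem inf_eq_zero_of_le_s11 {E : Type*} [Lattice E] [Zero E] {a b c : E} (h : b ⊓ c = 0) (ha : 0 ≤ a) (hc : 0 ≤ c)
    (hab : a ≤ b) : a ⊓ c = 0 :=
  le_antisymm ((inf_le_inf_right c hab).trans h.le) (le_inf ha hc)

theorem IsOrthomorphism.inf_abs_eq_zero {E : Type*} [Lattice E] [AddCommGroup E] [Module ℝ E]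
    {f : E →ₗ[ℝ] E} (hf : IsOrthomorphism f) {x y : E} (h : |x| ⊓ |y| = 0) :
    |f x| ⊓ |f y| = 0 := by
  have h1 := hf.2 x y h
  rw [inf_comm] at h1 ⊢
  exact hf.2 y (f x) h1

section

variable {E : Type*} [Lattice E] [AddCommGroup E] [IsOrderedAddMonoid E]

theorem inf_add_le_inf_add_inf {a b c : E} (ha : 0 ≤ a) (hb : 0 ≤ b) (hc : 0 ≤ c) :
    a ⊓ (b + c) ≤ a ⊓ b + a ⊓ c := by
  rw [inf_add]
  refine le_inf (inf_le_left.trans (le_add_of_nonneg_right (le_inf ha hc))) ?_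
  rw [add_inf]
  exact le_inf (inf_le_left.trans (le_add_of_nonneg_left hb)) inf_le_right

theorem inf_add_eq_zero_s11 {a b c : E} (ha : 0 ≤ a) (hb : 0 ≤ b) (hc : 0 ≤ c)
    (hab : a ⊓ b = 0) (hac : a ⊓ c = 0) : a ⊓ (b + c) = 0 := by
  refine le_antisymm ?_ (le_inf ha (add_nonneg hb hc))
  simpa [hab, hac] using inf_add_le_inf_add_inf ha hb hc

theorem add_le_of_inf_eq_zero {a b c : E} (h : a ⊓ b = 0) (ha : a ≤ c) (hb : b ≤ c) :
    a + b ≤ c := by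
  rw [← inf_add_sup a b, h, zero_add]
  exact sup_le ha hb

theorem IsLUB.inf_eq_zero {s : Set E} {p c : E} (hp : IsLUB s p) (hp0 : 0 ≤ p) (hc : 0 ≤ c)
    (h : ∀ v ∈ s, v ⊓ c = 0) : p ⊓ c = 0 := by
  refine le_antisymm ?_ (le_inf hp0 hc)
  have hle : p ≤ p ⊔ c - c := hp.2 fun v hv =>
    le_sub_iff_add_le.2 (add_le_of_inf_eq_zero (h v hv) ((hp.1 hv).trans le_sup_left) le_sup_right)
  rw [le_sub_iff_add_le, ← inf_add_sup p c] at hle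
  exact add_le_iff_nonpos_left.1 hle

theorem abs_le_abs_add_of_inf_eq_zero {a b : E} (h : |a| ⊓ |b| = 0) : |a| ≤ |a + b| := by
  have h1 : |a| ≤ |a + b| + |b| := by
    simpa using abs_add_le (a + b) (-b)
  calc |a| = |a| ⊓ (|a + b| + |b|) := (inf_eq_left.2 h1).symm
    _ ≤ |a| ⊓ |a + b| + |a| ⊓ |b| :=
      inf_add_le_inf_add_inf (abs_nonneg _) (abs_nonneg _) (abs_nonneg _)
    _ ≤ |a + b| := by rw [h, add_zero]; exact inf_le_right

theorem abs_add_abs_le_of_inf_eq_zero {a b : E} (h : |a| ⊓ |b| = 0) : |a| + |b| ≤ |a + b| := by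
  refine add_le_of_inf_eq_zero h (abs_le_abs_add_of_inf_eq_zero h) ?_
  rw [add_comm]
  exact abs_le_abs_add_of_inf_eq_zero (inf_comm |a| |b| ▸ h)

theorem le_of_add_self_le_add_self {a b : E} (h : a + a ≤ b + b) : a ≤ b := by
  rw [← sub_nonneg] at h ⊢
  refine nsmul_two_semiclosed ?_
  rw [two_nsmul]
  convert h using 1
  abel

theorem abs_add_abs_self_le (a : E) : |a| + |a| ≤ |a + a| := by
  have h0 : 0 ≤ |a + a| := abs_nonneg _
  have h : (a ⊔ -a) + (a ⊔ -a) ≤ |a + a| := by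
    rw [sup_add, add_sup, add_sup, add_neg_cancel, neg_add_cancel, ← neg_add]
    exact sup_le (sup_le (le_abs_self _) h0) (sup_le h0 (neg_le_abs _))
  exact h

/-- In a Dedekind complete lattice-ordered group, doubling an element `z` of `[0, y]` gives
a component of `y` plus another element of `[0, y]`. -/
theorem DedekindComplete.exists_component (hDC : DedekindComplete E) {y z : E}
    (hz : 0 ≤ z) (hzy : z ≤ y) :
    ∃ p z' : E, z + z = p + z' ∧ 0 ≤ p ∧ p ≤ y ∧ p ⊓ (y - p) = 0 ∧ 0 ≤ z' ∧ z' ≤ y := by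
  have hy : 0 ≤ y := hz.trans hzy
  set w : E := z + z - y with hw
  have hwp : w⁺ ≤ y := sup_le (sub_le_iff_le_add.2 (add_le_add hzy hzy)) hy
  have hwn : w⁻ ≤ y := sup_le (by rw [hw, neg_sub]; exact sub_le_self y (add_nonneg hz hz)) hy
  have hn0 : 0 ≤ w⁻ := negPart_nonneg w
  let s : Set E := {v | 0 ≤ v ∧ v ≤ y ∧ v ⊓ w⁻ = 0}
  have hws : w⁺ ∈ s := ⟨posPart_nonneg w, hwp, posPart_inf_negPart_eq_zero w⟩
  obtain ⟨p, hp⟩ := hDC s ⟨_, hws⟩ ⟨y, fun v hv => hv.2.1⟩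
  have hwle : w⁺ ≤ p := hp.1 hws
  have hp0 : 0 ≤ p := (posPart_nonneg w).trans hwle
  have hpy : p ≤ y := hp.2 fun v hv => hv.2.1
  have hpn : p ⊓ w⁻ = 0 := hp.inf_eq_zero hp0 hn0 fun v hv => hv.2.2
  refine ⟨p, z + z - p, by abel, hp0, hpy, ?_, ?_, ?_⟩
  · have ht0 : 0 ≤ p ⊓ (y - p) := le_inf hp0 (sub_nonneg.2 hpy)
    have hmem : p + p ⊓ (y - p) ∈ s := by
      refine ⟨add_nonneg hp0 ht0, ?_, ?_⟩
      · rw [← le_sub_iff_add_le']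
        exact inf_le_right
      · rw [inf_comm]
        exact inf_add_eq_zero_s11 hn0 hp0 ht0 (by rw [inf_comm, hpn])
          (by rw [inf_comm]; exact inf_eq_zero_of_le_s11 hpn ht0 hn0 inf_le_left)
    exact le_antisymm ((add_le_iff_nonpos_right p).1 (hp.1 hmem)) ht0
  · have h1 : p + w⁻ ≤ y := add_le_of_inf_eq_zero hpn hpy hwn
    have h2 : p + -w ≤ y := (add_le_add_right (neg_le_negPart w) p).trans h1
    rw [hw] at h2
    rw [sub_nonneg]
    have h3 : p + -(z + z - y) = p - (z + z) + y := by abel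
    rw [h3] at h2
    exact sub_nonpos.1 (add_le_iff_nonpos_left.1 h2)
  · have h1 : w ≤ p := (le_posPart w).trans hwle
    exact sub_le_iff_le_add'.2 (sub_le_iff_le_add.1 h1)

variable [Module ℝ E]

namespace IsOrthomorphism

variable {f g : E →ₗ[ℝ] E}

theorem sub (hf : IsOrthomorphism f) (hg : IsOrthomorphism g) : IsOrthomorphism (f - g) := by
  have hle (x : E) : |(f - g) x| ≤ |f x| + |g x| := by
    simpa [sub_eq_add_neg] using abs_add_le (f x) (-g x)
  refine ⟨fun x hx => ?_, fun x y h => ?_⟩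
  · obtain ⟨b, hb⟩ := hf.1 x hx
    obtain ⟨c, hc⟩ := hg.1 x hx
    exact ⟨b + c, fun y hy => (hle y).trans (add_le_add (hb y hy) (hc y hy))⟩
  · refine inf_eq_zero_of_le_s11 ?_ (abs_nonneg _) (abs_nonneg _) (hle x)
    rw [inf_comm]
    exact inf_add_eq_zero_s11 (abs_nonneg _) (abs_nonneg _) (abs_nonneg _)
      (by rw [inf_comm, hf.2 x y h]) (by rw [inf_comm, hg.2 x y h])

theorem abs_apply_le_abs_apply_abs (hf : IsOrthomorphism f) (z : E) : |f z| ≤ |f (|z|)| := by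
  have h : |f (z⁺)| ⊓ |f (z⁻)| = 0 := hf.inf_abs_eq_zero (by
    rw [abs_of_nonneg (posPart_nonneg z), abs_of_nonneg (negPart_nonneg z),
      posPart_inf_negPart_eq_zero])
  calc |f z| = |f (z⁺) + -f (z⁻)| := by
        rw [← sub_eq_add_neg, ← map_sub, posPart_sub_negPart]
    _ ≤ |f (z⁺)| + |f (z⁻)| := by simpa using abs_add_le (f (z⁺)) (-f (z⁻))
    _ ≤ |f (z⁺) + f (z⁻)| := abs_add_abs_le_of_inf_eq_zero h
    _ = |f (|z|)| := by rw [← map_add, posPart_add_negPart]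

theorem abs_apply_le_of_nonneg (hDC : DedekindComplete E) (hf : IsOrthomorphism f) {y z : E}
    (hz : 0 ≤ z) (hzy : z ≤ y) : |f z| ≤ |f y| := by
  have hy : 0 ≤ y := hz.trans hzy
  obtain ⟨b, hb⟩ := hf.1 y hy
  have hmem {u : E} (hu : 0 ≤ u) (huy : u ≤ y) : |f u| ∈ (fun v => |f v|) '' Set.Icc 0 y :=
    ⟨u, ⟨hu, huy⟩, rfl⟩
  obtain ⟨m, hm⟩ := hDC ((fun v => |f v|) '' Set.Icc 0 y) ⟨_, hmem hz hzy⟩ ⟨b, by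
    rintro _ ⟨v, hv, rfl⟩
    exact hb v ⟨(neg_nonpos.2 hy).trans hv.1, hv.2⟩⟩
  obtain ⟨c, hc⟩ := Module.exists_add_self_eq (|f y| + m)
  have hmc : m ≤ c := hm.2 (by
    rintro _ ⟨v, hv, rfl⟩
    obtain ⟨p, v', hpv, hp, hpy, hdisj, hv0, hvy⟩ := hDC.exists_component hv.1 hv.2
    have hcomp : |f p| ≤ |f y| := by
      have h := hf.inf_abs_eq_zero (x := p) (y := y - p) (by
        rwa [abs_of_nonneg hp, abs_of_nonneg (sub_nonneg.2 hpy)])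
      have h' := abs_le_abs_add_of_inf_eq_zero h
      rwa [← map_add, add_sub_cancel] at h'
    refine le_of_add_self_le_add_self ?_
    calc |f v| + |f v| ≤ |f v + f v| := abs_add_abs_self_le _
      _ = |f p + f v'| := by rw [← map_add, hpv, map_add]
      _ ≤ |f p| + |f v'| := abs_add_le _ _
      _ ≤ |f y| + m := add_le_add hcomp (hm.1 (hmem hv0 hvy))
      _ = c + c := hc.symm)
  have hmm : m + m ≤ |f y| + m := hc ▸ add_le_add hmc hmc
  exact (hm.1 (hmem hz hzy)).trans (le_of_add_le_add_right hmm)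

theorem abs_apply_le (hDC : DedekindComplete E) (hf : IsOrthomorphism f) {y z : E}
    (hzy : |z| ≤ y) : |f z| ≤ |f y| :=
  (hf.abs_apply_le_abs_apply_abs z).trans (hf.abs_apply_le_of_nonneg hDC (abs_nonneg z) hzy)

theorem add_self_le_abs_apply (hDC : DedekindComplete E) (hf : IsOrthomorphism f) {D : Set E}
    (hD : IsGLB D 0) {u d₀ : E} (hu : ∀ d ∈ D, u ≤ |f d|) (hd₀ : d₀ ∈ D) :
    u + u ≤ |f d₀| := by
  obtain ⟨e, he⟩ := Module.exists_add_self_eq d₀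
  have he0 : 0 ≤ e := le_of_add_self_le_add_self (by rw [he, add_zero]; exact hD.1 hd₀)
  suffices hue : u ≤ |f e| by
    calc u + u ≤ |f e| + |f e| := add_le_add hue hue
      _ ≤ |f e + f e| := abs_add_abs_self_le _
      _ = |f d₀| := by rw [← map_add, he]
  set w : E := (u - |f e|)⁺ with hw
  have hw0 : 0 ≤ w := posPart_nonneg _
  have hwq : ∀ d ∈ D, w ≤ |f ((d - e)⁺)| := fun d hd => by
    refine sup_le ?_ (abs_nonneg _)
    rw [sub_le_iff_le_add']
    have hsplit : d = d ⊓ e + (d - e)⁺ := by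
      rw [inf_eq_sub_posPart_sub, sub_add_cancel]
    calc u ≤ |f d| := hu d hd
      _ = |f (d ⊓ e) + f ((d - e)⁺)| := by rw [← map_add, ← hsplit]
      _ ≤ |f (d ⊓ e)| + |f ((d - e)⁺)| := abs_add_le _ _
      _ ≤ |f e| + |f ((d - e)⁺)| := by
        exact add_le_add_left
          (hf.abs_apply_le_of_nonneg hDC (le_inf (hD.1 hd) he0) inf_le_right) _
  have hwe : w ⊓ e = 0 := by
    refine le_antisymm (hD.2 fun d hd => ?_) (le_inf hw0 he0)
    have hn0 : 0 ≤ (d - e)⁻ := negPart_nonneg _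
    have hq : |f ((d - e)⁺)| ⊓ (d - e)⁻ = 0 := by
      have := hf.2 (d - e)⁺ (d - e)⁻ (by
        rw [abs_of_nonneg (posPart_nonneg _), abs_of_nonneg hn0, posPart_inf_negPart_eq_zero])
      rwa [abs_of_nonneg hn0] at this
    have hele : e ≤ (d - e)⁻ + d := by
      rw [← sub_le_iff_le_add, ← neg_sub]
      exact neg_le_negPart _
    calc w ⊓ e ≤ w ⊓ ((d - e)⁻ + d) := inf_le_inf_left w hele
      _ ≤ w ⊓ (d - e)⁻ + w ⊓ d := inf_add_le_inf_add_inf hw0 hn0 (hD.1 hd)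
      _ ≤ d := by
        rw [inf_eq_zero_of_le_s11 hq hw0 hn0 (hwq d hd), zero_add]
        exact inf_le_right
  have hwf : w ≤ |f e| := by
    have h := hwq d₀ hd₀
    rwa [← he, add_sub_cancel_right, posPart_of_nonneg he0] at h
  have hfw : |f e| ⊓ w = 0 := by
    have := hf.2 e w (by rw [abs_of_nonneg he0, abs_of_nonneg hw0, inf_comm, hwe])
    rwa [abs_of_nonneg hw0] at this
  have hw_zero : w = 0 := by rw [← hfw, inf_eq_right.2 hwf]
  exact sub_nonpos.1 (posPart_eq_zero.1 hw_zero)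

/-- An orthomorphism is order continuous at `0` along sets of infimum `0`. -/
theorem isGLB_image_abs (hDC : DedekindComplete E) (hf : IsOrthomorphism f) {D : Set E}
    (hne : D.Nonempty) (hD : IsGLB D 0) : IsGLB ((fun d => |f d|) '' D) 0 := by
  obtain ⟨d₀, hd₀⟩ := hne
  have h0 : (0 : E) ∈ lowerBounds ((fun d => |f d|) '' D) := by
    rintro _ ⟨d, -, rfl⟩
    exact abs_nonneg _
  obtain ⟨g, hg⟩ := hDC (lowerBounds ((fun d => |f d|) '' D)) ⟨0, h0⟩
    ⟨|f d₀|, fun l hl => hl ⟨d₀, hd₀, rfl⟩⟩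
  have hgle : ∀ d ∈ D, g ≤ |f d| := fun d hd => hg.2 fun l hl => hl ⟨d, hd, rfl⟩
  have hgg : g + g ≤ g := hg.1 (by
    rintro _ ⟨d, hd, rfl⟩
    exact hf.add_self_le_abs_apply hDC hD hgle hd)
  exact ⟨h0, fun l hl => (hg.1 hl).trans (add_le_iff_nonpos_left.1 hgg)⟩

theorem of_orderTendsto {ι : Type*} [Preorder ι] {S : ι → E →ₗ[ℝ] E}
    (hS : ∀ a, IsOrthomorphism (S a)) (hf : IsOrderBoundedMap f)
    (h : ∀ x : E, OrderTendsto (fun a => S a x) (f x)) : IsOrthomorphism f := by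
  refine ⟨hf, fun x y hxy => ?_⟩
  obtain ⟨D, -, -, hD, hconv⟩ := h x
  refine le_antisymm (hD.2 fun d hd => ?_) (le_inf (abs_nonneg _) (abs_nonneg _))
  obtain ⟨a, ha⟩ := hconv d hd
  have hle : |f x| ≤ |S a x| + d := by
    calc |f x| = |S a x + -(S a x - f x)| := by congr 1; abel
      _ ≤ |S a x| + |S a x - f x| := by simpa only [abs_neg] using abs_add_le (S a x) (-(S a x - f x))
      _ ≤ |S a x| + d := by gcongr; exact ha a le_rfl
  calc |f x| ⊓ |y| ≤ |y| ⊓ (|S a x| + d) := by rw [inf_comm]; exact inf_le_inf_left _ hle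
    _ ≤ |y| ⊓ |S a x| + |y| ⊓ d :=
      inf_add_le_inf_add_inf (abs_nonneg _) (abs_nonneg _) (hD.1 hd)
    _ ≤ d := by
      rw [inf_comm, (hS a).2 x y hxy, zero_add]
      exact inf_le_right

end IsOrthomorphism

theorem OrderTendsto.orthomorphism_apply (hDC : DedekindComplete E)
    {ι κ : Type*} [Preorder ι] [Preorder κ] {S : ι → E →ₗ[ℝ] E} {f : E →ₗ[ℝ] E}
    (hS : ∀ a, IsOrthomorphism (S a)) (hf : IsOrthomorphism f)
    (h : ∀ x : E, OrderTendsto (fun a => S a x) (f x)) {t : κ → E} {l : E}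
    (ht : OrderTendsto t l) :
    OrderTendsto (fun p : ι × κ => S p.1 (t p.2)) (f l) := by
  obtain ⟨D, ⟨d₀, hd₀⟩, hdir, hD, hconv⟩ := ht
  obtain ⟨D', ⟨c₀, hc₀⟩, hdir', hD', hconv'⟩ := h (|l| + d₀)
  refine ⟨{v | ∃ c ∈ D', ∃ d ∈ D, d ≤ d₀ ∧ v = c + |f d|},
    ⟨_, c₀, hc₀, d₀, hd₀, le_rfl, rfl⟩, ?_, ⟨?_, fun m hm => ?_⟩, ?_⟩
  · rintro _ ⟨c₁, hc₁, d₁, hd₁, hle₁, rfl⟩ _ ⟨c₂, hc₂, d₂, hd₂, -, rfl⟩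
    obtain ⟨c, hc, hcc₁, hcc₂⟩ := hdir' c₁ hc₁ c₂ hc₂
    obtain ⟨d, hd, hdd₁, hdd₂⟩ := hdir d₁ hd₁ d₂ hd₂
    exact ⟨_, ⟨c, hc, d, hd, hdd₁.trans hle₁, rfl⟩,
      add_le_add hcc₁ (hf.abs_apply_le_of_nonneg hDC (hD.1 hd) hdd₁),
      add_le_add hcc₂ (hf.abs_apply_le_of_nonneg hDC (hD.1 hd) hdd₂)⟩
  · rintro _ ⟨c, hc, d, -, -, rfl⟩
    exact add_nonneg (hD'.1 hc) (abs_nonneg _)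
  · refine (hf.isGLB_image_abs hDC ⟨d₀, hd₀⟩ hD).2 ?_
    rintro _ ⟨d₁, hd₁, rfl⟩
    obtain ⟨d, hd, hdd₁, hdd₀⟩ := hdir d₁ hd₁ d₀ hd₀
    refine le_trans (sub_nonpos.1 (hD'.2 fun c hc => ?_))
      (hf.abs_apply_le_of_nonneg hDC (hD.1 hd) hdd₁)
    exact sub_le_iff_le_add.2 (hm ⟨c, hc, d, hd, hdd₀, rfl⟩)
  · rintro _ ⟨c, hc, d, hd, hle, rfl⟩
    obtain ⟨a₀, ha₀⟩ := hconv' c hc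
    obtain ⟨b₀, hb₀⟩ := hconv d hd
    refine ⟨(a₀, b₀), fun p hp => ?_⟩
    have hb : |t p.2 - l| ≤ d := hb₀ p.2 hp.2
    have ht_le : |t p.2| ≤ |l| + d₀ := by
      calc |t p.2| = |l + (t p.2 - l)| := by rw [add_sub_cancel]
        _ ≤ |l| + |t p.2 - l| := abs_add_le _ _
        _ ≤ |l| + d₀ := by gcongr; exact hb.trans hle
    calc |S p.1 (t p.2) - f l| = |(S p.1 - f) (t p.2) + f (t p.2 - l)| := by
          rw [LinearMap.sub_apply, map_sub]
          congr 1
          abel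
      _ ≤ |(S p.1 - f) (t p.2)| + |f (t p.2 - l)| := abs_add_le _ _
      _ ≤ |(S p.1 - f) (|l| + d₀)| + |f d| :=
        add_le_add (((hS p.1).sub hf).abs_apply_le hDC ht_le) (hf.abs_apply_le hDC hb)
      _ ≤ c + |f d| := by gcongr; exact ha₀ p.1 hp.1

end



/-- Let `E` be a Dedekind complete vector lattice.  If a net `(S_α)`
of orthomorphisms is strongly order convergent to an order bounded operator `S`, and a
net `(T_β)` of order bounded operators is strongly order convergent to an order
bounded operator `T`, then `S` is an orthomorphism and `(S_α ∘ T_β)` is strongly order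
convergent to `S ∘ T`. -/
theorem stmt11 {E : Type*}
    [Lattice E] [AddCommGroup E] [CovariantClass E E (· + ·) (· ≤ ·)] [Module ℝ E]
    (hDC : DedekindComplete E)
    {ι κ : Type*} [Preorder ι] [Preorder κ]
    (S : ι → E →ₗ[ℝ] E) (hS : ∀ a, IsOrthomorphism (S a))
    (Slim : E →ₗ[ℝ] E) (hSlimob : IsOrderBoundedMap Slim)
    (hSconv : ∀ x : E, OrderTendsto (fun a => S a x) (Slim x))
    (T : κ → E →ₗ[ℝ] E) (hT : ∀ b, IsOrderBoundedMap (T b))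
    (Tlim : E →ₗ[ℝ] E) (hTlimob : IsOrderBoundedMap Tlim)
    (hTconv : ∀ x : E, OrderTendsto (fun b => T b x) (Tlim x)) :
    IsOrthomorphism Slim ∧
    ∀ x : E, OrderTendsto (fun p : ι × κ => S p.1 (T p.2 x)) (Slim (Tlim x)) := by
  have : IsOrderedAddMonoid E := { add_le_add_left := fun a b h c => add_le_add_left h c }
  have hSlim := IsOrthomorphism.of_orderTendsto hS hSlimob hSconv
  exact ⟨hSlim, fun x => (hTconv x).orthomorphism_apply hDC hS hSlim hSconv⟩
end

section
/- Let E = ℓ₁ with standard unit vectors (e_n). Define S_{i,j} ∈ L_ob(E) by S_{i,j} e_n = e_j if n = i and 0 otherwise, define T x = (Σ_{i≥2} x_i) e₃, and set S_n = S_{1,2} − S_{1,n+3}. Then 𝒜 = span{T, S_n : n ≥ 1} is a subalgebra of L_oc(E), S_n is uo-convergent to S_{1,2} in L_ob(E), T and S_{1,2} lie in the uo-adherence of 𝒜, yet T S_{1,2} = S_{1,3} is disjoint from every element of 𝒜 and hence does not lie in the uo-adherence of 𝒜. In particular, the uo-adherence of a subalgebra of L_oc(E) need not be a subalgebra. -/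
open Filter

section Adh
universe u
variable {E : Type*} [Lattice E] [AddCommGroup E]
  [CovariantClass E E (· + ·) (· ≤ ·)]

/-- The order adherence of a set: all order limits of nets from the set. -/
def orderAdherence (A : Set E) : Set E :=
  {l | ∃ (ι : Type u) (_ : Preorder ι) (_ : Nonempty ι),
      (∀ a b : ι, ∃ c : ι, a ≤ c ∧ b ≤ c) ∧
      ∃ x : ι → E, (∀ a, x a ∈ A) ∧ OrderTendsto x l}

/-- The unbounded order adherence of a set. -/
def uoAdherence (A : Set E) : Set E :=
  {l | ∃ (ι : Type u) (_ : Preorder ι) (_ : Nonempty ι),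
      (∀ a b : ι, ∃ c : ι, a ≤ c ∧ b ≤ c) ∧
      ∃ x : ι → E, (∀ a, x a ∈ A) ∧ UOTendsto x l}

/-- The sequential order adherence of a set. -/
def seqOrderAdherence (A : Set E) : Set E :=
  {l | ∃ x : ℕ → E, (∀ n, x n ∈ A) ∧ OrderTendsto x l}

/-- The sequential unbounded order adherence of a set. -/
def seqUOAdherence (A : Set E) : Set E :=
  {l | ∃ x : ℕ → E, (∀ n, x n ∈ A) ∧ UOTendsto x l}

end Adh

open MeasureTheory ENNReal

/-- The standard unit vector `e_n` of `ℓ₁`, realized as `L¹` of counting measure. -/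
noncomputable def eL1 (n : ℕ) : Lp ℝ 1 (Measure.count : Measure ℕ) :=
  indicatorConstLp 1 (MeasurableSet.singleton n) (by simp) (1 : ℝ)

namespace L1Count

variable (x y : Lp ℝ 1 (Measure.count : Measure ℕ)) (c : ℝ) (i : ℕ)

lemma add_apply : (x + y) i = x i + y i := Measure.ae_count_iff.1 (Lp.coeFn_add x y) i

lemma neg_apply : (-x) i = -x i := Measure.ae_count_iff.1 (Lp.coeFn_neg x) i

lemma sub_apply : (x - y) i = x i - y i := Measure.ae_count_iff.1 (Lp.coeFn_sub x y) i

lemma smul_apply : (c • x) i = c * x i := Measure.ae_count_iff.1 (Lp.coeFn_smul c x) i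

lemma abs_apply : |x| i = |x i| := Measure.ae_count_iff.1 (Lp.coeFn_abs x) i

lemma zero_apply : (0 : Lp ℝ 1 (Measure.count : Measure ℕ)) i = 0 :=
  Measure.ae_count_iff.1 (Lp.coeFn_zero ℝ 1 Measure.count) i

variable {x y}

lemma le_iff : x ≤ y ↔ ∀ i, x i ≤ y i := by
  rw [← Lp.coeFn_le]; exact Measure.ae_count_iff

lemma nonneg_iff : 0 ≤ x ↔ ∀ i, 0 ≤ x i := by
  simp only [le_iff, zero_apply]

lemma ext (h : ∀ i, x i = y i) : x = y := Lp.ext (Measure.ae_count_iff.2 h)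

variable (x)

lemma summable_abs : Summable fun i => |x i| := by
  have h := integrable_count_iff.1 (L1.integrable_coeFn x)
  simpa using h.abs

lemma norm_eq_tsum : ‖x‖ = ∑' i, |x i| := by
  rw [L1.norm_eq_integral_norm, integral_countable (L1.integrable_coeFn x).norm]
  simp [Measure.real]

lemma abs_apply_le_norm : |x i| ≤ ‖x‖ := by
  rw [norm_eq_tsum]
  exact (summable_abs x).le_tsum i fun _ _ => abs_nonneg _

lemma eL1_apply (k : ℕ) : eL1 k i = if i = k then 1 else 0 := by
  have h := Measure.ae_count_iff.1 (indicatorConstLp_coeFn (p := 1) (μ := Measure.count)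
    (hs := MeasurableSet.singleton k) (hμs := by simp) (c := (1 : ℝ))) i
  rw [eL1, h]
  simp [Set.indicator_apply]

lemma eL1_nonneg (k : ℕ) : 0 ≤ eL1 k := by
  rw [nonneg_iff]
  intro i
  rw [eL1_apply]
  positivity

variable {x i}

lemma sum_apply {ι : Type*} (s : Finset ι) (f : ι → Lp ℝ 1 (Measure.count : Measure ℕ)) :
    (∑ a ∈ s, f a) i = ∑ a ∈ s, f a i := by
  classical
  induction s using Finset.induction_on with
  | empty => simp
  | insert a s ha ih => rw [Finset.sum_insert ha, Finset.sum_insert ha, add_apply, ih]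

lemma apply_smul_eL1_le (hx : 0 ≤ x) (i : ℕ) : x i • eL1 i ≤ x := by
  rw [le_iff]
  intro k
  rw [smul_apply, eL1_apply]
  split_ifs with h
  · simp [h]
  · simpa using nonneg_iff.1 hx k

/-- The `ℓ₁`-norm is order continuous. -/
lemma exists_norm_lt_of_isGLB {D : Set (Lp ℝ 1 (Measure.count : Measure ℕ))}
    (hne : D.Nonempty) (hdir : DirectedOn (· ≥ ·) D) (hD : IsGLB D 0) {ε : ℝ} (hε : 0 < ε) :
    ∃ d ∈ D, ‖d‖ < ε := by
  obtain ⟨d₀, hd₀⟩ := hne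
  let D' : Type := {d : Lp ℝ 1 (Measure.count : Measure ℕ) // d ∈ D ∧ d ≤ d₀}
  have : Nonempty D' := ⟨⟨d₀, hd₀, le_rfl⟩⟩
  have : IsCodirectedOrder D' := ⟨by
    rintro ⟨a, ha, ha'⟩ ⟨b, hb, hb'⟩
    obtain ⟨c, hc, hca, hcb⟩ := hdir a ha b hb
    exact ⟨(⟨c, hc, le_trans hca ha'⟩ : D'), hca, hcb⟩⟩
  have hpos (d : D') (i : ℕ) : 0 ≤ d.1 i := nonneg_iff.1 (hD.1 d.2.1) i
  have hcoord (i : ℕ) : Tendsto (fun d : D' => |d.1 i|) atBot (nhds 0) := by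
    simp_rw [fun d : D' => abs_of_nonneg (hpos d i)]
    refine tendsto_atBot_isGLB (fun a b hab => le_iff.1 hab i) ⟨?_, ?_⟩
    · rintro _ ⟨d, rfl⟩
      exact hpos d i
    · intro b hb
      have hlb : b • eL1 i ∈ lowerBounds D := by
        intro d hd
        obtain ⟨c, hc, hcd, hcd₀⟩ := hdir d hd d₀ hd₀
        have hbc : b ≤ c i := hb ⟨⟨c, hc, hcd₀⟩, rfl⟩
        refine le_trans ?_ (le_trans (apply_smul_eL1_le (hD.1 hc) i) hcd)
        rw [le_iff]
        intro k
        rw [smul_apply, smul_apply]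
        exact mul_le_mul_of_nonneg_right hbc (nonneg_iff.1 (eL1_nonneg i) k)
      have h := le_iff.1 (hD.2 hlb) i
      simpa [smul_apply, eL1_apply, zero_apply] using h
  have hlim : Tendsto (fun d : D' => ‖d.1‖) atBot (nhds 0) := by
    simp_rw [norm_eq_tsum]
    have := tendsto_tsum_of_dominated_convergence (f := fun (d : D') i => |d.1 i|)
      (𝓕 := atBot) (summable_abs d₀) hcoord (Eventually.of_forall fun d i => by
        rw [Real.norm_eq_abs, abs_abs, abs_of_nonneg (hpos d i)]
        exact (le_iff.1 d.2.2 i).trans (le_abs_self _))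
    simpa using this
  obtain ⟨d, hd⟩ := (hlim.eventually_lt_const hε).exists
  exact ⟨d.1, d.2.1, hd⟩

/-- An operator dominated by `x ↦ ‖x‖ • u` is order continuous, since the norm is. -/
lemma isOrderContinuousMap_of_abs_le_norm_smul
    {f : Lp ℝ 1 (Measure.count : Measure ℕ) →ₗ[ℝ] Lp ℝ 1 (Measure.count : Measure ℕ)}
    {u : Lp ℝ 1 (Measure.count : Measure ℕ)} (hu : 0 ≤ u) (hf : ∀ x, |f x| ≤ ‖x‖ • u) :
    IsOrderContinuousMap f := by
  have hmono {a b : ℝ} (hab : a ≤ b) : a • u ≤ b • u := by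
    rw [le_iff]
    intro i
    rw [smul_apply, smul_apply]
    exact mul_le_mul_of_nonneg_right hab (nonneg_iff.1 hu i)
  rintro ι _ x l ⟨D, hne, hdir, hD, hx⟩
  refine ⟨(fun d => ‖d‖ • u) '' D, hne.image _, ?_, ⟨?_, ?_⟩, ?_⟩
  · rintro _ ⟨a, ha, rfl⟩ _ ⟨b, hb, rfl⟩
    obtain ⟨c, hc, hca, hcb⟩ := hdir a ha b hb
    exact ⟨_, ⟨c, hc, rfl⟩, hmono (norm_le_norm_of_abs_le_abs (abs_le_abs_of_nonneg (hD.1 hc) hca)),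
      hmono (norm_le_norm_of_abs_le_abs (abs_le_abs_of_nonneg (hD.1 hc) hcb))⟩
  · rintro _ ⟨a, -, rfl⟩
    simpa using hmono (norm_nonneg a)
  · intro b hb
    rw [le_iff]
    intro i
    rw [zero_apply]
    by_contra! hbi
    have hle {d} (hd : d ∈ D) : b i ≤ ‖d‖ * u i := by
      simpa [smul_apply] using le_iff.1 (hb ⟨d, hd, rfl⟩) i
    have hui : 0 < u i + 1 := by linarith [nonneg_iff.1 hu i]
    obtain ⟨d, hd, hlt⟩ := exists_norm_lt_of_isGLB hne hdir hD (div_pos hbi hui)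
    rw [lt_div_iff₀ hui] at hlt
    nlinarith [hle hd, norm_nonneg d]
  · rintro _ ⟨d, hd, rfl⟩
    obtain ⟨a₀, ha₀⟩ := hx d hd
    refine ⟨a₀, fun a ha => ?_⟩
    rw [← map_sub]
    refine (hf _).trans (hmono (norm_le_norm_of_abs_le_abs ?_))
    rw [abs_of_nonneg (hD.1 hd)]
    exact ha₀ a ha

end L1Count

lemma UOTendsto.mem_uoAdherence {E : Type*} [Lattice E] [AddCommGroup E]
    [CovariantClass E E (· + ·) (· ≤ ·)] {A : Set E} {x : ℕ → E} {l : E}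
    (hx : ∀ n, x n ∈ A) (h : UOTendsto x l) : l ∈ uoAdherence A := by
  refine ⟨ULift ℕ, inferInstance, inferInstance, fun a b => ⟨a ⊔ b, le_sup_left, le_sup_right⟩,
    fun a => x a.down, fun a => hx _, fun y hy => ?_⟩
  obtain ⟨D, hne, hdir, hD, hlim⟩ := h y hy
  refine ⟨D, hne, hdir, hD, fun d hd => ?_⟩
  obtain ⟨a₀, ha₀⟩ := hlim d hd
  exact ⟨⟨a₀⟩, fun a ha => ha₀ a.down ha⟩

lemma uoTendsto_const {E : Type*} [Lattice E] [AddCommGroup E]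
    [CovariantClass E E (· + ·) (· ≤ ·)] (l : E) : UOTendsto (fun _ : ℕ => l) l := by
  intro y hy
  refine ⟨{0}, Set.singleton_nonempty _, directedOn_singleton _, isGLB_singleton, ?_⟩
  rintro _ rfl
  exact ⟨0, fun _ _ => by simp [hy]⟩

lemma abs_le_abs_sub_of_abs_inf_abs_eq_zero {E : Type*} [Lattice E] [AddCommGroup E]
    [CovariantClass E E (· + ·) (· ≤ ·)] {s x : E} (h : |s| ⊓ |x| = 0) : |s| ≤ |x - s| := by
  rw [← sub_nonpos, ← h]
  refine le_inf (sub_le_self _ (abs_nonneg _)) ?_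
  rw [sub_le_iff_le_add, add_comm]
  have := abs_add_le (s - x) x
  rwa [sub_add_cancel, abs_sub_comm] at this

/-- An element disjoint from `A` lies in the uo-adherence of `A` only if it is zero. -/
lemma eq_zero_of_mem_uoAdherence_of_disjoint {E : Type*} [Lattice E] [AddCommGroup E]
    [CovariantClass E E (· + ·) (· ≤ ·)] {A : Set E} {s : E}
    (hA : ∀ f ∈ A, |s| ⊓ |f| = 0) (hs : s ∈ uoAdherence A) : s = 0 := by
  obtain ⟨ι, _, _, -, x, hxA, hx⟩ := hs
  obtain ⟨D, -, -, hD, hlim⟩ := hx |s| (abs_nonneg s)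
  have hle : |s| ≤ 0 := by
    refine hD.2 fun d hd => ?_
    obtain ⟨a, ha⟩ := hlim d hd
    refine le_trans ?_ (ha a le_rfl)
    beta_reduce
    rw [sub_zero, inf_eq_right.2 (abs_le_abs_sub_of_abs_inf_abs_eq_zero (hA _ (hxA a))), abs_abs]
  exact le_antisymm ((le_abs_self s).trans hle) (neg_nonpos.1 ((neg_le_abs s).trans hle))

namespace IsLobLattice

open L1Count

variable {𝕃 : Type*} [Lattice 𝕃] [AddCommGroup 𝕃] [Module ℝ 𝕃]
  {j : 𝕃 →ₗ[ℝ] (Lp ℝ 1 (Measure.count : Measure ℕ)) →ₗ[ℝ] (Lp ℝ 1 (Measure.count : Measure ℕ))}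
  (hj : IsLobLattice (Lp ℝ 1 (Measure.count : Measure ℕ)) 𝕃 j)
include hj

lemma le_iff_apply {f g : 𝕃} :
    f ≤ g ↔ ∀ x, 0 ≤ x → ∀ i, j f x i ≤ j g x i := by
  simp only [hj.le_iff, L1Count.le_iff]

/-- The operator `x ↦ x i • v` is order bounded. -/
lemma exists_rankOne (i : ℕ) (v : Lp ℝ 1 (Measure.count : Measure ℕ)) :
    ∃ V : 𝕃, ∀ x, j V x = x i • v := by
  let f : (Lp ℝ 1 (Measure.count : Measure ℕ)) →ₗ[ℝ] (Lp ℝ 1 (Measure.count : Measure ℕ)) :=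
    { toFun := fun x => x i • v
      map_add' := fun x y => by rw [add_apply, add_smul]
      map_smul' := fun c x => by rw [L1Count.smul_apply, mul_smul]; rfl }
  obtain ⟨V, hV⟩ := (hj.mem_range_iff f).2 fun x _ => ⟨x i • |v|, fun y hy => by
    have hyi : |y i| ≤ x i := abs_le.2
      ⟨(neg_apply x i).ge.trans (L1Count.le_iff.1 hy.1 i), L1Count.le_iff.1 hy.2 i⟩
    rw [L1Count.le_iff]
    intro k
    change |y i • v| k ≤ _
    simp only [abs_apply, L1Count.smul_apply, abs_mul]
    exact mul_le_mul_of_nonneg_right hyi (abs_nonneg _)⟩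
  exact ⟨V, fun x => by rw [hV]; rfl⟩

variable {S : 𝕃} {i k : ℕ} (hS : ∀ x, j S x = x i • eL1 k)
include hS

lemma nonneg_of_unit : 0 ≤ S := by
  rw [hj.le_iff]
  intro x hx
  rw [hS, map_zero, LinearMap.zero_apply, nonneg_iff]
  intro n
  rw [L1Count.smul_apply]
  exact mul_nonneg (nonneg_iff.1 hx i) (nonneg_iff.1 (eL1_nonneg k) n)

/-- On the positive cone, an operator below `x ↦ x i • e_k` is bounded by its value on `e_i`. -/
lemma apply_le_smul_of_le_unit {W : 𝕃} (hW : W ≤ S) {x : Lp ℝ 1 (Measure.count : Measure ℕ)}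
    (hx : 0 ≤ x) (n : ℕ) : j W x n ≤ x i * j W (eL1 i) n := by
  have h := hj.le_iff_apply.1 hW (x - x i • eL1 i) (sub_nonneg.2 (apply_smul_eL1_le hx i)) n
  simp only [hS, map_sub, map_smul, sub_apply, L1Count.smul_apply, eL1_apply] at h
  simp only [if_true, mul_one, sub_self, zero_mul] at h
  linarith

lemma apply_le_zero_of_le_unit {W : 𝕃} (hW : W ≤ S) {n : ℕ} (hn : n ≠ k) :
    j W (eL1 i) n ≤ 0 := by
  have h := hj.le_iff_apply.1 hW (eL1 i) (eL1_nonneg i) n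
  simpa [hS, L1Count.smul_apply, eL1_apply, hn] using h

variable [CovariantClass 𝕃 𝕃 (· + ·) (· ≤ ·)]

/-- If `f` is dominated by an operator `g` with `(g e_i)_k = 0`, then `f` is disjoint from
`x ↦ x i • e_k`. -/
lemma abs_inf_abs_eq_zero {f g : 𝕃} (hfg : |f| ≤ g) (hg : j g (eL1 i) k = 0) :
    |S| ⊓ |f| = 0 := by
  have hS0 := hj.nonneg_of_unit hS
  rw [abs_of_nonneg hS0]
  refine le_antisymm ?_ (le_inf hS0 (abs_nonneg f))
  rw [hj.le_iff_apply]
  intro x hx n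
  rw [map_zero, LinearMap.zero_apply, zero_apply]
  refine (hj.apply_le_smul_of_le_unit hS inf_le_left hx n).trans
    (mul_nonpos_of_nonneg_of_nonpos (nonneg_iff.1 hx i) ?_)
  rcases eq_or_ne n k with rfl | hn
  · exact (hj.le_iff_apply.1 (inf_le_right.trans hfg) _ (eL1_nonneg i) n).trans hg.le
  · exact hj.apply_le_zero_of_le_unit hS inf_le_left hn

omit hS

/-- The disjoint sequence of operators `x ↦ x i • e_n` is uo-null. -/
lemma orderTendsto_unit_inf {S : ℕ → 𝕃} (hS : ∀ k x, j (S k) x = x i • eL1 k) (m : ℕ) {y : 𝕃}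
    (hy : 0 ≤ y) : OrderTendsto (fun n => S (n + m) ⊓ y) 0 := by
  obtain ⟨V, hV⟩ := hj.exists_rankOne i (j y (eL1 i))
  set v := j y (eL1 i) with hv
  have hv0 (k : ℕ) : 0 ≤ v k := by
    simpa [zero_apply] using hj.le_iff_apply.1 hy (eL1 i) (eL1_nonneg i) k
  let R (N : ℕ) : 𝕃 := V - ∑ k ∈ Finset.range N, v k • S k
  have hR (N : ℕ) (x : Lp ℝ 1 (Measure.count : Measure ℕ)) (n : ℕ) :
      j (R N) x n = x i * if n < N then 0 else v n := by
    simp only [R, map_sub, map_sum, map_smul, LinearMap.sub_apply, LinearMap.sum_apply,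
      LinearMap.smul_apply, hV, hS, sub_apply, sum_apply, L1Count.smul_apply, eL1_apply]
    simp only [mul_ite, mul_one, mul_zero, Finset.sum_ite_eq, Finset.mem_range]
    split_ifs <;> ring
  have hanti : Antitone R := by
    intro M N hMN
    rw [hj.le_iff_apply]
    intro x hx n
    rw [hR, hR]
    refine mul_le_mul_of_nonneg_left ?_ (nonneg_iff.1 hx i)
    split_ifs with h₁ h₂
    · exact le_rfl
    · exact hv0 n
    · omega
    · exact le_rfl
  refine ⟨Set.range R, Set.range_nonempty R, ?_, ⟨?_, fun b hb => ?_⟩, ?_⟩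
  · rintro _ ⟨M, rfl⟩ _ ⟨N, rfl⟩
    exact ⟨_, ⟨max M N, rfl⟩, hanti (le_max_left _ _), hanti (le_max_right _ _)⟩
  · rintro _ ⟨N, rfl⟩
    rw [hj.le_iff_apply]
    intro x hx n
    rw [hR, map_zero, LinearMap.zero_apply, zero_apply]
    refine mul_nonneg (nonneg_iff.1 hx i) ?_
    split_ifs
    exacts [le_rfl, hv0 n]
  · rw [hj.le_iff_apply]
    intro x hx n
    have h := hj.le_iff_apply.1 (hb ⟨n + 1, rfl⟩) x hx n
    rw [hR, if_pos n.lt_succ_self, mul_zero] at h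
    simpa [zero_apply] using h
  · rintro _ ⟨N, rfl⟩
    refine ⟨N, fun a ha => ?_⟩
    rw [sub_zero, abs_of_nonneg (le_inf (hj.nonneg_of_unit (hS _)) hy), hj.le_iff_apply]
    intro x hx n
    refine (hj.apply_le_smul_of_le_unit (hS _) inf_le_left hx n).trans ?_
    rw [hR]
    refine mul_le_mul_of_nonneg_left ?_ (nonneg_iff.1 hx i)
    rcases eq_or_ne n (a + m) with rfl | hn
    · rw [if_neg (by omega)]
      exact hj.le_iff_apply.1 inf_le_right _ (eL1_nonneg i) _
    · refine (hj.apply_le_zero_of_le_unit (hS _) inf_le_left hn).trans ?_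
      split_ifs
      exacts [le_rfl, hv0 n]

end IsLobLattice

/-- On `E = ℓ₁`, with `S_{i,j} x = x_i • e_j`,
`T x = (Σ_{i ≥ 2} x_i) • e₃` and `S_n = S_{1,2} - S_{1,n+3}`, the linear span `𝒜` of
`{T} ∪ {S_n : n ≥ 1}` is a subalgebra of `L_oc(E)`; `(S_n)` uo-converges to `S_{1,2}`
in `L_ob(E)`, so `T` and `S_{1,2}` lie in the uo-adherence of `𝒜`; yet
`T ∘ S_{1,2} = S_{1,3}` is disjoint from every member of `𝒜` and does not lie in the
uo-adherence of `𝒜`.  In particular the uo-adherence of a subalgebra of `L_oc(E)`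
need not be a subalgebra.  Here `(𝕃, j)` realizes `L_ob(E)`. -/
theorem stmt14 {𝕃 : Type*}
    [Lattice 𝕃] [AddCommGroup 𝕃] [CovariantClass 𝕃 𝕃 (· + ·) (· ≤ ·)] [Module ℝ 𝕃]
    (j : 𝕃 →ₗ[ℝ] (Lp ℝ 1 (Measure.count : Measure ℕ)) →ₗ[ℝ]
      (Lp ℝ 1 (Measure.count : Measure ℕ)))
    (hj : IsLobLattice (Lp ℝ 1 (Measure.count : Measure ℕ)) 𝕃 j)
    (S : ℕ → ℕ → 𝕃) (T : 𝕃)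
    (hS : ∀ i k : ℕ, ∀ x : Lp ℝ 1 (Measure.count : Measure ℕ),
      j (S i k) x = x i • eL1 k)
    (hT : ∀ x : Lp ℝ 1 (Measure.count : Measure ℕ),
      j T x = (∑' i : ℕ, if 2 ≤ i then x i else 0) • eL1 3) :
    let 𝒜 : Set 𝕃 := (Submodule.span ℝ
      ({T} ∪ {g : 𝕃 | ∃ n : ℕ, 1 ≤ n ∧ g = S 1 2 - S 1 (n + 3)}) : Submodule ℝ 𝕃)
    -- `𝒜` is a subalgebra of `L_oc(E)`:
    (∀ f ∈ 𝒜, ∀ g ∈ 𝒜, ∀ h : 𝕃, j h = (j f).comp (j g) → h ∈ 𝒜) ∧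
    (∀ f ∈ 𝒜, IsOrderContinuousMap (j f)) ∧
    -- `S_n` uo-converges to `S_{1,2}` in `L_ob(E)`:
    UOTendsto (fun n : ℕ => S 1 2 - S 1 (n + 1 + 3)) (S 1 2) ∧
    T ∈ uoAdherence 𝒜 ∧ S 1 2 ∈ uoAdherence 𝒜 ∧
    -- but `T ∘ S_{1,2} = S_{1,3}` is disjoint from `𝒜` and outside its uo-adherence:
    (j T).comp (j (S 1 2)) = j (S 1 3) ∧
    (∀ f ∈ 𝒜, |S 1 3| ⊓ |f| = 0) ∧
    S 1 3 ∉ uoAdherence 𝒜 := by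
  intro 𝒜
  have hTe (k : ℕ) : j T (eL1 k) = if 2 ≤ k then eL1 3 else 0 := by
    rw [hT, tsum_eq_single k fun i hi => by simp [L1Count.eL1_apply, hi]]
    split_ifs <;> simp [L1Count.eL1_apply]
  have hTsum (x : Lp ℝ 1 (Measure.count : Measure ℕ)) :
      |∑' i : ℕ, if 2 ≤ i then x i else 0| ≤ ‖x‖ := by
    have hle (i : ℕ) : ‖if 2 ≤ i then x i else 0‖ ≤ |x i| := by
      split_ifs <;> simp
    rw [L1Count.norm_eq_tsum]
    exact tsum_of_norm_bounded (L1Count.summable_abs x).hasSum hle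
  have hT0 : 0 ≤ T := by
    rw [hj.le_iff]
    intro x hx
    rw [hT, map_zero, LinearMap.zero_apply, L1Count.nonneg_iff]
    intro n
    rw [L1Count.smul_apply]
    refine mul_nonneg (tsum_nonneg fun i => ?_) (L1Count.nonneg_iff.1 (L1Count.eL1_nonneg 3) n)
    split_ifs
    exacts [L1Count.nonneg_iff.1 hx i, le_rfl]
  have hSn (n : ℕ) (x : Lp ℝ 1 (Measure.count : Measure ℕ)) :
      j (S 1 2 - S 1 (n + 3)) x = x 1 • (eL1 2 - eL1 (n + 3)) := by
    rw [map_sub, LinearMap.sub_apply, hS, hS, smul_sub]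
  have hT𝒜 : T ∈ 𝒜 := Submodule.subset_span (Or.inl rfl)
  have hS𝒜 (n : ℕ) : S 1 2 - S 1 (n + 1 + 3) ∈ 𝒜 :=
    Submodule.subset_span (Or.inr ⟨n + 1, by omega, rfl⟩)
  have hrange : ∀ g ∈ 𝒜, ∀ x, j g x 1 = 0 := by
    intro g hg x
    induction hg using Submodule.span_induction with
    | mem g hg =>
      rcases hg with rfl | ⟨n, -, rfl⟩
      · simp [hT, L1Count.smul_apply, L1Count.eL1_apply]
      · rw [hSn, L1Count.smul_apply, L1Count.sub_apply]
        simp [L1Count.eL1_apply]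
    | zero => simp
    | add f g _ _ hf hg => rw [map_add, LinearMap.add_apply, L1Count.add_apply, hf, hg, add_zero]
    | smul c g _ hg => rw [map_smul, LinearMap.smul_apply, L1Count.smul_apply, hg, mul_zero]
  have hleft : ∀ f ∈ 𝒜, ∃ c : ℝ, ∀ z : Lp ℝ 1 (Measure.count : Measure ℕ), z 1 = 0 →
      j f z = c • j T z := by
    intro f hf
    induction hf using Submodule.span_induction with
    | mem f hf =>
      rcases hf with rfl | ⟨n, -, rfl⟩
      · exact ⟨1, fun z _ => (one_smul _ _).symm⟩
      · exact ⟨0, fun z hz => by rw [hSn, hz, zero_smul, zero_smul]⟩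
    | zero => exact ⟨0, fun z _ => by simp⟩
    | add f g _ _ hf hg =>
      obtain ⟨a, ha⟩ := hf
      obtain ⟨b, hb⟩ := hg
      exact ⟨a + b, fun z hz => by rw [map_add, LinearMap.add_apply, ha z hz, hb z hz, add_smul]⟩
    | smul c f _ hf =>
      obtain ⟨a, ha⟩ := hf
      exact ⟨c * a, fun z hz => by rw [map_smul, LinearMap.smul_apply, ha z hz, mul_smul]⟩
  have hright : ∀ g ∈ 𝒜, ∃ c : ℝ, ∀ x, j T (j g x) = c • j T x := by
    intro g hg
    induction hg using Submodule.span_induction with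
    | mem g hg =>
      rcases hg with rfl | ⟨n, -, rfl⟩
      · exact ⟨1, fun x => by
          conv_lhs => rw [hT x, map_smul, hTe, if_pos (by norm_num)]
          rw [one_smul, hT]⟩
      · exact ⟨0, fun x => by
          rw [hSn, map_smul, map_sub, hTe, hTe, if_pos le_rfl, if_pos (by omega), sub_self,
            smul_zero, zero_smul]⟩
    | zero => exact ⟨0, fun x => by simp⟩
    | add f g _ _ hf hg =>
      obtain ⟨a, ha⟩ := hf
      obtain ⟨b, hb⟩ := hg
      exact ⟨a + b, fun x => by rw [map_add, LinearMap.add_apply, map_add, ha, hb, add_smul]⟩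
    | smul c g _ hg =>
      obtain ⟨a, ha⟩ := hg
      exact ⟨c * a, fun x => by rw [map_smul, LinearMap.smul_apply, map_smul, ha, mul_smul]⟩
  have hbound : ∀ f ∈ 𝒜, ∃ u : Lp ℝ 1 (Measure.count : Measure ℕ), 0 ≤ u ∧
      ∀ x i, |j f x i| ≤ ‖x‖ * u i := by
    intro f hf
    induction hf using Submodule.span_induction with
    | mem f hf =>
      rcases hf with rfl | ⟨n, -, rfl⟩
      · refine ⟨eL1 3, L1Count.eL1_nonneg 3, fun x i => ?_⟩
        have h := L1Count.nonneg_iff.1 (L1Count.eL1_nonneg 3) i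
        rw [hT, L1Count.smul_apply, abs_mul, abs_of_nonneg h]
        exact mul_le_mul_of_nonneg_right (hTsum x) h
      · refine ⟨eL1 2 + eL1 (n + 3), add_nonneg (L1Count.eL1_nonneg _) (L1Count.eL1_nonneg _),
          fun x i => ?_⟩
        have h := L1Count.nonneg_iff.1 (L1Count.eL1_nonneg 2) i
        have h' := L1Count.nonneg_iff.1 (L1Count.eL1_nonneg (n + 3)) i
        rw [hSn, L1Count.smul_apply, L1Count.sub_apply, L1Count.add_apply, abs_mul]
        refine mul_le_mul (L1Count.abs_apply_le_norm x 1) ?_ (abs_nonneg _) (norm_nonneg x)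
        exact abs_le.2 ⟨by linarith, by linarith⟩
    | zero => exact ⟨0, le_rfl, fun x i => by simp⟩
    | add f g _ _ hf hg =>
      obtain ⟨u, hu, huf⟩ := hf
      obtain ⟨v, hv, hvg⟩ := hg
      refine ⟨u + v, add_nonneg hu hv, fun x i => ?_⟩
      rw [map_add, LinearMap.add_apply, L1Count.add_apply, L1Count.add_apply, mul_add]
      exact (abs_add_le _ _).trans (add_le_add (huf x i) (hvg x i))
    | smul c f _ hf =>
      obtain ⟨u, hu, huf⟩ := hf
      refine ⟨|c| • u, L1Count.nonneg_iff.2 fun i => ?_, fun x i => ?_⟩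
      · rw [L1Count.smul_apply]
        exact mul_nonneg (abs_nonneg c) (L1Count.nonneg_iff.1 hu i)
      · rw [map_smul, LinearMap.smul_apply, L1Count.smul_apply, L1Count.smul_apply, abs_mul,
          mul_left_comm]
        exact mul_le_mul_of_nonneg_left (huf x i) (abs_nonneg c)
  have hdom : ∀ f ∈ 𝒜, ∃ g : 𝕃, |f| ≤ g ∧ j g (eL1 1) 3 = 0 := by
    intro f hf
    induction hf using Submodule.span_induction with
    | mem f hf =>
      rcases hf with rfl | ⟨n, hn, rfl⟩
      · exact ⟨f, (abs_of_nonneg hT0).le, by simp [hTe]⟩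
      · refine ⟨S 1 2 + S 1 (n + 3), ?_, ?_⟩
        · rw [sub_eq_add_neg]
          refine (abs_add_le _ _).trans_eq ?_
          rw [abs_neg, abs_of_nonneg (hj.nonneg_of_unit (hS 1 2)),
            abs_of_nonneg (hj.nonneg_of_unit (hS 1 (n + 3)))]
        · have hn' : n ≠ 0 := by omega
          rw [map_add, LinearMap.add_apply, L1Count.add_apply, hS, hS, L1Count.smul_apply,
            L1Count.smul_apply]
          simp [L1Count.eL1_apply, hn']
    | zero => exact ⟨0, abs_zero.le, by simp⟩
    | add f g _ _ hf hg =>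
      obtain ⟨a, ha, ha'⟩ := hf
      obtain ⟨b, hb, hb'⟩ := hg
      exact ⟨a + b, (abs_add_le f g).trans (add_le_add ha hb), by
        rw [map_add, LinearMap.add_apply, L1Count.add_apply, ha', hb', add_zero]⟩
    | smul c f _ hf =>
      obtain ⟨g, hg, hg'⟩ := hf
      refine ⟨|c| • g, ?_, by
        rw [map_smul, LinearMap.smul_apply, L1Count.smul_apply, hg', mul_zero]⟩
      have hfg : ∀ x : Lp ℝ 1 (Measure.count : Measure ℕ), 0 ≤ x → ∀ i,
          |j f x i| ≤ j g x i := by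
        intro x hx i
        have h₁ := hj.le_iff_apply.1 ((le_abs_self f).trans hg) x hx i
        have h₂ := hj.le_iff_apply.1 ((neg_le_abs f).trans hg) x hx i
        rw [map_neg, LinearMap.neg_apply, L1Count.neg_apply] at h₂
        exact abs_le'.2 ⟨h₁, h₂⟩
      have hmul (x : Lp ℝ 1 (Measure.count : Measure ℕ)) (hx : 0 ≤ x) (i : ℕ) :
          |c * j f x i| ≤ |c| * j g x i := by
        rw [abs_mul]
        exact mul_le_mul_of_nonneg_left (hfg x hx i) (abs_nonneg c)
      refine abs_le'.2 ⟨?_, ?_⟩ <;> rw [hj.le_iff_apply] <;> intro x hx i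
      · rw [map_smul, map_smul, LinearMap.smul_apply, LinearMap.smul_apply, L1Count.smul_apply,
          L1Count.smul_apply]
        exact (le_abs_self _).trans (hmul x hx i)
      · rw [map_neg, map_smul, map_smul, LinearMap.neg_apply, LinearMap.smul_apply,
          LinearMap.smul_apply, L1Count.neg_apply, L1Count.smul_apply, L1Count.smul_apply]
        exact (neg_le_abs _).trans (hmul x hx i)
  have huo : UOTendsto (fun n : ℕ => S 1 2 - S 1 (n + 1 + 3)) (S 1 2) := by
    intro y hy
    have h := hj.orderTendsto_unit_inf (hS 1) 4 hy
    convert h using 2 with n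
    rw [sub_sub_cancel_left, abs_neg, abs_of_nonneg (hj.nonneg_of_unit (hS 1 _))]
  have hdisj : ∀ f ∈ 𝒜, |S 1 3| ⊓ |f| = 0 := by
    intro f hf
    obtain ⟨g, hfg, hg⟩ := hdom f hf
    exact hj.abs_inf_abs_eq_zero (hS 1 3) hfg hg
  refine ⟨?_, ?_, huo, (uoTendsto_const T).mem_uoAdherence fun _ => hT𝒜,
    huo.mem_uoAdherence hS𝒜, ?_, hdisj, ?_⟩
  · intro f hf g hg h hh
    obtain ⟨a, ha⟩ := hleft f hf
    obtain ⟨b, hb⟩ := hright g hg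
    have hhT : h = (a * b) • T := by
      refine hj.inj (LinearMap.ext fun x => ?_)
      rw [hh, LinearMap.comp_apply, ha _ (hrange g hg x), hb, map_smul, LinearMap.smul_apply,
        mul_smul]
    rw [hhT]
    exact Submodule.smul_mem _ _ hT𝒜
  · intro f hf
    obtain ⟨u, hu, huf⟩ := hbound f hf
    refine L1Count.isOrderContinuousMap_of_abs_le_norm_smul hu fun x => ?_
    rw [L1Count.le_iff]
    intro i
    rw [L1Count.abs_apply, L1Count.smul_apply]
    exact huf x i
  · refine LinearMap.ext fun x => ?_
    rw [LinearMap.comp_apply, hS, hS, map_smul, hTe, if_pos le_rfl]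
  · intro hmem
    have h := congrArg (fun R => j R (eL1 1) 3) (eq_zero_of_mem_uoAdherence_of_disjoint hdisj hmem)
    simp [hS, L1Count.eL1_apply] at h
end
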